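/- arXiv:1212.1943 — 2 statements merged into one kernel-verified Lean document; each statement's English description precedes it below -/
import Mathlib

section
/- Let G be an injective labeled oriented tree and let H be a sub-LOT of G. Then the group homomorphism G(H) → G(G) induced by the inclusion of generating sets (sending each generator of P(H) to the same-named generator of P(G), which is well defined since every relator of P(H) is a relator of P(G)) is injective; in other words, the LOT group G(H) embeds as a subgroup of the LOT group G(G). -/
/-- A labeled oriented graph (LOG): each edge `e` has an initial vertex `init e`,
a terminal vertex `term e`, and a label `label e`, which is a vertex.
An edge `e = [x,z,y]` has `init e = x`, `label e = z`, `term e = y`. -/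
structure LOG (V E : Type) where
  init : E → V
  label : E → V
  term : E → V

namespace LOG

variable {V E : Type}

/-- The underlying simple graph of a LOG. -/
def graph (G : LOG V E) : SimpleGraph V :=
  SimpleGraph.fromRel fun a b => ∃ e, G.init e = a ∧ G.term e = b

/-- The underlying unoriented multigraph is a tree: there are no loops, distinct
edges have distinct endpoint pairs, and the underlying simple graph is a tree. -/
def IsTreeGraph (G : LOG V E) : Prop :=
  (∀ e, G.init e ≠ G.term e) ∧
    Function.Injective (fun e => s(G.init e, G.term e)) ∧ G.graph.IsTree

/-- A LOG is injective if each vertex occurs at most once as an edge label. -/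
def InjectiveLabels (G : LOG V E) : Prop := Function.Injective G.label

/-- The simple graph induced by a subgraph, given by a vertex set `VS` and an edge set `ES`. -/
def subgraph (G : LOG V E) (VS : Set V) (ES : Set E) : SimpleGraph VS :=
  SimpleGraph.fromRel fun a b => ∃ e ∈ ES, G.init e = (a : V) ∧ G.term e = (b : V)

/-- A sub-LOT: a connected subgraph containing at least one edge, all of whose
edge labels are vertices of the subgraph. -/
structure IsSubLOT (G : LOG V E) (VS : Set V) (ES : Set E) : Prop where
  edge_nonempty : ES.Nonempty
  init_mem : ∀ e ∈ ES, G.init e ∈ VS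
  term_mem : ∀ e ∈ ES, G.term e ∈ VS
  label_mem : ∀ e ∈ ES, G.label e ∈ VS
  connected : (G.subgraph VS ES).Connected

/-- The relators `x z (z y)⁻¹` of the LOT presentation `P(G)`. -/
def rels (G : LOG V E) : Set (FreeGroup V) :=
  Set.range fun e =>
    FreeGroup.of (G.init e) * FreeGroup.of (G.label e) *
      (FreeGroup.of (G.label e) * FreeGroup.of (G.term e))⁻¹

/-- The relators of the LOT presentation of the sub-LOT given by `(VS, ES)`,
as words in the generators `VS`. -/
def subRels (G : LOG V E) (VS : Set V) (ES : Set E) : Set (FreeGroup VS) :=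
  { r | ∃ e ∈ ES, ∃ (hi : G.init e ∈ VS) (hl : G.label e ∈ VS) (ht : G.term e ∈ VS),
      r = FreeGroup.of (⟨G.init e, hi⟩ : VS) * FreeGroup.of (⟨G.label e, hl⟩ : VS) *
        (FreeGroup.of (⟨G.label e, hl⟩ : VS) * FreeGroup.of (⟨G.term e, ht⟩ : VS))⁻¹ }

end LOG

/-- Data for a family of relations between the letters `L`, with coefficients in a group `N`:
for every index `i` either the relation `a ν z = z μ b` or the relation `a ν z μ b = z`, together
with the commutation rule `n o = o τ(n)` for the distinguished letter `o`. -/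
structure ConjData (N L I : Type) [Group N] where
  o : L
  τ : N ≃* N
  z : I → L
  a : I → L
  b : I → L
  ν : I → N
  μ : I → N
  twisted : I → Prop

namespace ConjData

variable {N L I : Type} [Group N]

/-- The relations satisfied by the inverses of the letters. -/
def dual (D : ConjData N L I) : ConjData N L I where
  o := D.o
  τ := D.τ.symm
  z := D.z
  a := D.b
  b := D.a
  ν := fun i => (D.μ i)⁻¹
  μ := fun i => (D.ν i)⁻¹
  twisted := D.twisted

/-- An action of the letters by injective maps satisfying the relations. -/
structure IsModel (D : ConjData N L I) {X : Type} [MulAction N X] (f : L → X → X) : Prop where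
  inj : ∀ l, Function.Injective (f l)
  slide : ∀ (n : N) x, n • f D.o x = f D.o (D.τ n • x)
  square : ∀ i, ¬ D.twisted i → ∀ x,
    f (D.a i) (D.ν i • f (D.z i) x) = f (D.z i) (D.μ i • f (D.b i) x)
  triangle : ∀ i, D.twisted i → ∀ x,
    f (D.a i) (D.ν i • f (D.z i) (D.μ i • f (D.b i) x)) = f (D.z i) x

theorem IsModel.dual_dual {D : ConjData N L I} {X : Type} [MulAction N X] {f : L → X → X}
    (h : D.IsModel f) : D.dual.dual.IsModel f where
  inj := h.inj
  slide := h.slide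
  square i hi x := by simpa [dual] using h.square i hi x
  triangle i hi x := by simpa [dual] using h.triangle i hi x

/-- An orientation of the graph with edges `{z i, a i}` towards the letter `o`: the edge `i` joins
the child `hi i` to its parent `lo i`. -/
structure Rooting (D : ConjData N L I) where
  flip : I → Prop
  depth : L → ℕ
  hi : I → L
  lo : I → L
  flip_spec : ∀ i, flip i → hi i = D.a i ∧ lo i = D.z i
  not_flip_spec : ∀ i, ¬ flip i → hi i = D.z i ∧ lo i = D.a i
  hi_injective : Function.Injective hi
  hi_ne : ∀ i, hi i ≠ D.o
  depth_lt : ∀ i, depth (lo i) < depth (hi i)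

/-- A rank function decreasing along the edges `z i → a i` yields an orientation towards `o`. -/
theorem nonempty_rooting (D : ConjData N L I) (hz : Function.Injective D.z) (r : L → ℕ)
    (hr : ∀ i, r (D.a i) < r (D.z i)) : Nonempty D.Rooting := by
  classical
  let S : L → L → Prop := fun x y => ∃ i, D.z i = x ∧ D.a i = y
  have hS : Relator.RightUnique S := by
    rintro x y y' ⟨i, hi, rfl⟩ ⟨j, hj, rfl⟩
    rw [hz (hi.trans hj.symm)]
  have hrank : ∀ {x y}, Relation.ReflTransGen S x y → r y ≤ r x := by
    intro x y h
    induction h with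
    | refl => exact le_rfl
    | tail _ h ih =>
      obtain ⟨i, rfl, rfl⟩ := h
      exact (hr i).le.trans ih
  let On : L → Prop := Relation.ReflTransGen S D.o
  have hstep : ∀ i, On (D.z i) → On (D.a i) := fun i h => h.tail ⟨i, rfl, rfl⟩
  have key : ∀ i j, Relation.ReflTransGen S (D.z i) (D.z j) → D.a i = D.a j → i = j := by
    intro i j h hij
    rcases Relation.ReflTransGen.cases_head h with h | ⟨c, ⟨k, hk, rfl⟩, h⟩
    · exact hz h
    · have := hrank h
      have h2 := hr j
      rw [hz hk, hij] at this
      omega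
  refine ⟨⟨fun i => On (D.z i), fun x => if On x then r D.o - r x else r D.o + 1 + r x,
    fun i => if On (D.z i) then D.a i else D.z i, fun i => if On (D.z i) then D.z i else D.a i,
    fun i h => by simp [h], fun i h => by simp [h], ?_, ?_, ?_⟩⟩
  · intro i j hij
    by_cases h1 : On (D.z i) <;> by_cases h2 : On (D.z j)
    · simp only [h1, h2, if_true] at hij
      rcases Relation.ReflTransGen.total_of_right_unique hS h1 h2 with h | h
      · exact key i j h hij
      · exact (key j i h hij.symm).symm
    · simp only [h1, h2, if_true, if_false] at hij
      exact absurd (hij ▸ hstep i h1) h2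
    · simp only [h1, h2, if_true, if_false] at hij
      exact absurd (hij ▸ hstep j h2) h1
    · simp only [h1, h2, if_false] at hij
      exact hz hij
  · intro i
    by_cases h : On (D.z i)
    · have h1 := hrank h
      have h2 := hr i
      simp only [h, if_true]
      intro h3
      rw [h3] at h2
      omega
    · simp only [h, if_false]
      intro h3
      exact h (h3 ▸ Relation.ReflTransGen.refl)
  · intro i
    have h2 := hr i
    by_cases h : On (D.z i)
    · have h1 := hrank h
      simp only [h, hstep i h, if_true]
      omega
    · simp only [h, if_false]
      split_ifs <;> omega

end ConjData

/-- Formal terms built from points of `P` by applying letters with coefficients. -/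
inductive LetterTerm (N L P : Type) where
  | pt (p : P) : LetterTerm N L P
  | app (h : N) (l : L) (e : LetterTerm N L P) : LetterTerm N L P

namespace LetterTerm

variable {N L I P : Type} [Group N] [MulAction N P]

instance : MulAction N (LetterTerm N L P) where
  smul n e := match e with
    | pt p => pt (n • p)
    | app h l e => app (n * h) l e
  one_smul e := by
    cases e with
    | pt p => exact congrArg pt (one_smul N p)
    | app h l e => exact congrArg (app · l e) (one_mul h)
  mul_smul m n e := by
    cases e with
    | pt p => exact congrArg pt (mul_smul m n p)
    | app h l e => exact congrArg (app · l e) (mul_assoc m n h)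

@[simp] theorem smul_pt (n : N) (p : P) : n • (pt p : LetterTerm N L P) = pt (n • p) := rfl

@[simp] theorem smul_app (n h : N) (l : L) (e : LetterTerm N L P) :
    n • app h l e = app (n * h) l e := rfl

/-- The congruence generated by the relations of `D` and, if `full` holds, by the requirement that
`g l` be a right inverse of `l`. The index bounds the number of uses of the relations of `D`. -/
inductive Rel (D : ConjData N L I) (g : L → P → P) (full : Prop) :
    ℕ → LetterTerm N L P → LetterTerm N L P → Prop
  | refl (w e) : Rel D g full w e e
  | symm {w e e'} : Rel D g full w e e' → Rel D g full w e' e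
  | trans {w v e e' e''} : Rel D g full w e e' → Rel D g full v e' e'' → Rel D g full (w + v) e e''
  | congr {w e e'} (h l) : Rel D g full w e e' → Rel D g full w (app h l e) (app h l e')
  | glue (w h l q) : full → Rel D g full w (app h l (pt (g l q))) (pt (h • q))
  | slide (w h e) : Rel D g full w (app h D.o e) (app 1 D.o (D.τ h • e))
  | square (w h i e) : ¬ D.twisted i → Rel D g full (w + 1)
      (app h (D.a i) (app (D.ν i) (D.z i) e)) (app h (D.z i) (app (D.μ i) (D.b i) e))
  | triangle (w h i e) : D.twisted i → Rel D g full (w + 1)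
      (app h (D.a i) (app (D.ν i) (D.z i) (app (D.μ i) (D.b i) e))) (app h (D.z i) e)

variable {D : ConjData N L I} {g : L → P → P} {full : Prop}

namespace Rel

theorem mono {w w' : ℕ} {e e' : LetterTerm N L P} (hw : w ≤ w') (h : Rel D g full w e e') :
    Rel D g full w' e e' := by
  have := h.trans (Rel.refl (w' - w) e')
  rwa [Nat.add_sub_cancel' hw] at this

theorem smul {w : ℕ} {e e' : LetterTerm N L P} (n : N) (h : Rel D g full w e e') :
    Rel D g full w (n • e) (n • e') := by
  induction h with
  | refl w e => exact .refl _ _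
  | symm _ ih => exact ih.symm
  | trans _ _ ih ih' => exact ih.trans ih'
  | congr h l h1 _ => exact .congr _ _ h1
  | glue w h l q hf =>
    rw [smul_pt, ← mul_smul]
    exact .glue _ _ _ _ hf
  | slide w h e =>
    have h1 := Rel.slide (D := D) (g := g) (full := full) w (n * h) e
    have h2 := Rel.slide (D := D) (g := g) (full := full) 0 n (D.τ h • e)
    rw [map_mul, mul_smul] at h1
    simpa using h1.trans h2.symm
  | square w h i e hi => exact .square _ _ _ _ hi
  | triangle w h i e hi => exact .triangle _ _ _ _ hi

theorem smul_iff {w : ℕ} {e e' : LetterTerm N L P} (n : N) :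
    Rel D g full w (n • e) (n • e') ↔ Rel D g full w e e' :=
  ⟨fun h => by simpa using h.smul n⁻¹, fun h => h.smul n⟩

end Rel

/-- Evaluation of terms in `P`, each letter `l` acting as the partial inverse of `g l`. -/
def EvaluatesTo (g : L → P → P) (full : Prop) : LetterTerm N L P → P → Prop
  | pt p', p => p' = p
  | app h l e, p => full ∧ EvaluatesTo g full e (g l (h⁻¹ • p))

theorem eval_smul (n : N) (e : LetterTerm N L P) (p : P) :
    EvaluatesTo g full (n • e) p ↔ EvaluatesTo g full e (n⁻¹ • p) := by
  cases e with
  | pt q => simp [EvaluatesTo, eq_inv_smul_iff]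
  | app h l e => simp [EvaluatesTo, mul_smul]

theorem Rel.eval_iff (hg : full → D.dual.IsModel g) {w : ℕ} {e e' : LetterTerm N L P}
    (h : Rel D g full w e e') : ∀ p, EvaluatesTo g full e p ↔ EvaluatesTo g full e' p := by
  induction h with
  | refl w e => simp
  | symm _ ih => exact fun p => (ih p).symm
  | trans _ _ ih ih' => exact fun p => (ih p).trans (ih' p)
  | congr h l _ ih => exact fun p => by simp [EvaluatesTo, ih]
  | glue w h l q hf =>
    intro p
    simp [EvaluatesTo, hf, ((hg hf).inj l).eq_iff, eq_inv_smul_iff]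
  | slide w h e =>
    intro p
    simp only [EvaluatesTo, eval_smul, inv_one, one_smul]
    refine and_congr_right fun hf => ?_
    have := (hg hf).slide (D.τ h⁻¹) p
    simp only [ConjData.dual, MulEquiv.symm_apply_apply] at this
    rw [← this, map_inv]
  | square w h i e hi =>
    intro p
    simp only [EvaluatesTo]
    refine and_congr_right fun hf => and_congr_right fun _ => ?_
    have := (hg hf).square i hi (h⁻¹ • p)
    simp only [ConjData.dual] at this
    rw [this]
  | triangle w h i e hi =>
    intro p
    simp only [EvaluatesTo]
    refine and_congr_right fun hf => ?_
    have := (hg hf).triangle i hi (h⁻¹ • p)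
    simp only [ConjData.dual] at this
    rw [this]
    simp [hf]

theorem Rel.pt_inj (hg : full → D.dual.IsModel g) {w : ℕ} {p q : P}
    (h : Rel D g full w (pt p : LetterTerm N L P) (pt q)) : p = q := by
  simpa [EvaluatesTo] using h.eval_iff hg q

/-- The side of relation `i` starting with `z`, with that letter removed. -/
noncomputable def restZ (D : ConjData N L I) (i : I) (e : LetterTerm N L P) : LetterTerm N L P :=
  open Classical in if D.twisted i then e else app (D.μ i) (D.b i) e

/-- The side of relation `i` starting with `a`, with that letter removed. -/
noncomputable def restA (D : ConjData N L I) (i : I) (e : LetterTerm N L P) : LetterTerm N L P :=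
  open Classical in
  if D.twisted i then app (D.ν i) (D.z i) (app (D.μ i) (D.b i) e) else app (D.ν i) (D.z i) e

/-- What remains of the side of relation `i` starting with the child. -/
noncomputable def restHi (R : D.Rooting) (i : I) (e : LetterTerm N L P) : LetterTerm N L P :=
  open Classical in if R.flip i then restA D i e else restZ D i e

/-- What remains of the side of relation `i` starting with the parent. -/
noncomputable def restLo (R : D.Rooting) (i : I) (e : LetterTerm N L P) : LetterTerm N L P :=
  open Classical in if R.flip i then restZ D i e else restA D i e

/-- Letters may be cancelled on the left from relations of weight `v`. -/
def Cancels (D : ConjData N L I) (g : L → P → P) (full : Prop) (v : ℕ) : Prop :=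
  ∀ (h : N) (l : L) (e e' : LetterTerm N L P),
    Rel D g full v (app h l e) (app h l e') → Rel D g full v e e'

theorem Rel.restZ {w : ℕ} {e e' : LetterTerm N L P} (i : I) (h : Rel D g full w e e') :
    Rel D g full w (restZ D i e) (restZ D i e') := by
  unfold LetterTerm.restZ
  split_ifs
  exacts [h, h.congr _ _]

theorem Rel.restA {w : ℕ} {e e' : LetterTerm N L P} (i : I) (h : Rel D g full w e e') :
    Rel D g full w (restA D i e) (restA D i e') := by
  unfold LetterTerm.restA
  split_ifs
  exacts [(h.congr _ _).congr _ _, h.congr _ _]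

theorem Rel.of_restZ {w : ℕ} {e e' : LetterTerm N L P} {i : I} (hc : Cancels D g full w)
    (h : Rel D g full w (LetterTerm.restZ D i e) (LetterTerm.restZ D i e')) :
    Rel D g full w e e' := by
  unfold LetterTerm.restZ at h
  split_ifs at h
  exacts [h, hc _ _ _ _ h]

theorem Rel.of_restA {w : ℕ} {e e' : LetterTerm N L P} {i : I} (hc : Cancels D g full w)
    (h : Rel D g full w (LetterTerm.restA D i e) (LetterTerm.restA D i e')) :
    Rel D g full w e e' := by
  unfold LetterTerm.restA at h
  split_ifs at h
  exacts [hc _ _ _ _ (hc _ _ _ _ h), hc _ _ _ _ h]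

theorem Rel.lo_of_hi {R : D.Rooting} {w : ℕ} {e e' : LetterTerm N L P} {i : I}
    (hc : Cancels D g full w) (h : Rel D g full w (restHi R i e) (restHi R i e')) :
    Rel D g full w (restLo R i e) (restLo R i e') := by
  unfold restHi at h
  unfold restLo
  split_ifs at h ⊢
  exacts [(h.of_restA hc).restZ i, (h.of_restZ hc).restA i]

theorem Rel.hi_of_lo {R : D.Rooting} {w : ℕ} {e e' : LetterTerm N L P} {i : I}
    (hc : Cancels D g full w) (h : Rel D g full w (restLo R i e) (restLo R i e')) :
    Rel D g full w (restHi R i e) (restHi R i e') := by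
  unfold restLo at h
  unfold restHi
  split_ifs at h ⊢
  exacts [(h.of_restZ hc).restA i, (h.of_restA hc).restZ i]

theorem exists_rest (hf : full) (hg : D.dual.IsModel g) (i : I) (q : P) :
    ∃ p : P, Rel D g full 0 (restZ D i (pt p : LetterTerm N L P)) (pt (g (D.z i) q)) ∧
      Rel D g full 0 (restA D i (pt p : LetterTerm N L P)) (pt (g (D.a i) q)) := by
  by_cases hi : D.twisted i
  · refine ⟨g (D.z i) q, by simpa [restZ, hi] using .refl _ _, ?_⟩
    have h := hg.triangle i hi q
    simp only [ConjData.dual] at h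
    have h1 := Rel.glue (D := D) (g := g) 0 (D.μ i) (D.b i)
      ((D.μ i)⁻¹ • g (D.z i) ((D.ν i)⁻¹ • g (D.a i) q)) hf
    have h2 := Rel.glue (D := D) (g := g) 0 (D.ν i) (D.z i) ((D.ν i)⁻¹ • g (D.a i) q) hf
    simp only [h, smul_inv_smul] at h1 h2
    simpa [restA, hi] using (h1.congr (D.ν i) (D.z i)).trans h2
  · refine ⟨g (D.b i) ((D.μ i)⁻¹ • g (D.z i) q), ?_, ?_⟩
    · simpa [restZ, hi] using Rel.glue (D := D) (g := g) 0 (D.μ i) (D.b i)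
        ((D.μ i)⁻¹ • g (D.z i) q) hf
    · have h := hg.square i hi q
      simp only [ConjData.dual] at h
      rw [h]
      simpa [restA, hi] using Rel.glue (D := D) (g := g) 0 (D.ν i) (D.z i)
        ((D.ν i)⁻¹ • g (D.a i) q) hf

theorem exists_hi_lo (R : D.Rooting) (hf : full) (hg : D.dual.IsModel g) (i : I) (q : P) :
    ∃ p : P, Rel D g full 0 (restHi R i (pt p : LetterTerm N L P)) (pt (g (R.hi i) q)) ∧
      Rel D g full 0 (restLo R i (pt p : LetterTerm N L P)) (pt (g (R.lo i) q)) := by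
  obtain ⟨p, h1, h2⟩ := exists_rest hf hg i q
  refine ⟨p, ?_⟩
  by_cases hi : R.flip i
  · simpa [restHi, restLo, hi, R.flip_spec] using ⟨h2, h1⟩
  · simpa [restHi, restLo, hi, R.not_flip_spec] using ⟨h1, h2⟩

/-- A normal form of the term `app h l e` with respect to the commutation rule. -/
noncomputable def norm (D : ConjData N L I) (l : L) (h : N) (e : LetterTerm N L P) :
    L × N × LetterTerm N L P :=
  open Classical in if l = D.o then (l, 1, D.τ h • e) else (l, h, e)

@[simp] theorem norm_fst (l : L) (h : N) (e : LetterTerm N L P) : (norm D l h e).1 = l := by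
  unfold norm; split_ifs <;> rfl

theorem norm_snd_fst (l : L) (h : N) (e e' : LetterTerm N L P) :
    (norm D l h e).2.1 = (norm D l h e').2.1 := by
  unfold norm; split_ifs <;> rfl

theorem rel_norm {w : ℕ} (l : L) (h : N) (e e' : LetterTerm N L P) :
    Rel D g full w (norm D l h e).2.2 (norm D l h e').2.2 ↔ Rel D g full w e e' := by
  unfold norm; split_ifs
  · exact Rel.smul_iff _
  · rfl

theorem norm_of_ne {l : L} (hl : l ≠ D.o) (h : N) (e : LetterTerm N L P) :
    norm D l h e = (l, h, e) := if_neg hl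

/-- States with the same leading letter and coefficient and equivalent remainders. -/
def Near (D : ConjData N L I) (g : L → P → P) (full : Prop) (w : ℕ)
    (s s' : L × N × LetterTerm N L P) : Prop :=
  s.1 = s'.1 ∧ s.2.1 = s'.2.1 ∧ Rel D g full w s.2.2 s'.2.2

theorem Near.symm {w : ℕ} {s s' : L × N × LetterTerm N L P} (h : Near D g full w s s') :
    Near D g full w s' s := ⟨h.1.symm, h.2.1.symm, h.2.2.symm⟩

theorem Near.trans {w v : ℕ} {s s' s'' : L × N × LetterTerm N L P} (h : Near D g full w s s')
    (h' : Near D g full v s' s'') : Near D g full (w + v) s s'' :=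
  ⟨h.1.trans h'.1, h.2.1.trans h'.2.1, h.2.2.trans h'.2.2⟩

theorem near_norm {w : ℕ} (l : L) (h : N) {e e' : LetterTerm N L P} (he : Rel D g full w e e') :
    Near D g full w (norm D l h e) (norm D l h e') :=
  ⟨by simp, norm_snd_fst _ _ _ _, (rel_norm _ _ _ _).2 he⟩

/-- `Up R g full n w s s'`: one passes from `s` to `s'` by `n` moves from child to parent. -/
def Up (R : D.Rooting) (g : L → P → P) (full : Prop) :
    ℕ → ℕ → L × N × LetterTerm N L P → L × N × LetterTerm N L P → Prop
  | 0, w, s, s' => Near D g full w s s'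
  | n + 1, w, s, s' => ∃ i e v v', v + v' + 1 ≤ w ∧ s.1 = R.hi i ∧
      Rel D g full v s.2.2 (restHi R i e) ∧
      Up R g full n v' (norm D (R.lo i) s.2.1 (restLo R i e)) s'

variable {R : D.Rooting}

theorem Up.near {n w v : ℕ} {s t s' : L × N × LetterTerm N L P} (h : Near D g full w s t)
    (hu : Up R g full n v t s') : Up R g full n (w + v) s s' := by
  cases n with
  | zero => exact h.trans hu
  | succ n =>
    obtain ⟨i, e, v1, v2, hv, h1, h2, h3⟩ := hu
    refine ⟨i, e, w + v1, v2, by omega, h.1.trans h1, h.2.2.trans h2, ?_⟩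
    rwa [h.2.1]

theorem Up.mono {n w v : ℕ} {s s' : L × N × LetterTerm N L P} (hwv : w ≤ v)
    (hu : Up R g full n w s s') : Up R g full n v s s' := by
  have : Near D g full (v - w) s s := ⟨rfl, rfl, .refl _ _⟩
  have := Up.near this hu
  rwa [Nat.sub_add_cancel hwv] at this

theorem Up.comp {n m w v : ℕ} {s t s' : L × N × LetterTerm N L P} (h : Up R g full n w s t)
    (h' : Up R g full m v t s') : Up R g full (n + m) (w + v) s s' := by
  induction n generalizing w s with
  | zero => rw [zero_add]; exact h'.near h
  | succ n ih =>
    obtain ⟨i, e, v1, v2, hv, h1, h2, h3⟩ := h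
    rw [Nat.succ_add]
    exact ⟨i, e, v1, v2 + v, by omega, h1, h2, ih h3⟩

theorem Up.depth_le {n w : ℕ} {s t : L × N × LetterTerm N L P} (h : Up R g full n w s t) :
    R.depth t.1 + n ≤ R.depth s.1 := by
  induction n generalizing w s with
  | zero => rw [h.1]; rfl
  | succ n ih =>
    obtain ⟨i, e, v1, v2, hv, h1, h2, h3⟩ := h
    have := ih h3
    have h4 := R.depth_lt i
    rw [norm_fst] at this
    rw [h1]
    omega

theorem Up.det {W : ℕ} (hc : ∀ v < W, Cancels D g full v) {n m w v : ℕ}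
    {s t t' : L × N × LetterTerm N L P} (h : Up R g full n w s t)
    (h' : Up R g full (n + m) v s t') (hW : w + v ≤ W) : Up R g full m (w + v) t t' := by
  induction n generalizing w v s with
  | zero => rw [zero_add] at h'; exact h'.near h.symm
  | succ n ih =>
    rw [Nat.succ_add] at h'
    obtain ⟨i, e, v1, v2, hv, h1, h2, h3⟩ := h
    obtain ⟨j, e', u1, u2, hu, k1, k2, k3⟩ := h'
    obtain rfl : i = j := R.hi_injective (h1.symm.trans k1)
    have h4 := (h2.symm.trans k2).lo_of_hi (hc _ (by omega))
    have h5 := k3.near (near_norm _ _ h4)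
    exact (ih h3 h5 (by omega)).mono (by omega)

theorem Up.rel_of_near_tags {W : ℕ} (hc : ∀ v < W, Cancels D g full v) {n m w v : ℕ}
    {s s' t : L × N × LetterTerm N L P} (h : Up R g full n w s t) (h' : Up R g full m v s' t)
    (hs : s.1 = s'.1) (hs' : s.2.1 = s'.2.1) (hW : w + v ≤ W) :
    Rel D g full (w + v) s.2.2 s'.2.2 := by
  induction n generalizing m w v s s' with
  | zero =>
    cases m with
    | zero => exact (h.trans h'.symm).2.2
    | succ m =>
      have := h'.depth_le
      rw [← h.1, hs] at this
      omega
  | succ n ih =>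
    cases m with
    | zero =>
      have := h.depth_le
      rw [← h'.1, hs] at this
      omega
    | succ m =>
      obtain ⟨i, e, v1, v2, hv, h1, h2, h3⟩ := h
      obtain ⟨j, e', u1, u2, hu, k1, k2, k3⟩ := h'
      obtain rfl : i = j := R.hi_injective (by rw [← h1, hs, k1])
      rw [← hs'] at k3
      have h4 := ih h3 k3 (by simp) (norm_snd_fst _ _ _ _) (by omega)
      rw [rel_norm] at h4
      exact ((h2.trans (h4.hi_of_lo (hc _ (by omega)))).trans k2.symm).mono (by omega)

/-- Two states with a common ancestor. -/
def Joined (R : D.Rooting) (g : L → P → P) (full : Prop) (w : ℕ)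
    (s s' : L × N × LetterTerm N L P) : Prop :=
  ∃ n m v v' t, v + v' ≤ w ∧ Up R g full n v s t ∧ Up R g full m v' s' t

theorem Joined.symm {w : ℕ} {s s' : L × N × LetterTerm N L P} (h : Joined R g full w s s') :
    Joined R g full w s' s := by
  obtain ⟨n, m, v, v', t, hv, h1, h2⟩ := h
  exact ⟨m, n, v', v, t, by omega, h2, h1⟩

theorem Joined.trans {W : ℕ} (hc : ∀ v < W, Cancels D g full v) {w v : ℕ}
    {s s' s'' : L × N × LetterTerm N L P} (h : Joined R g full w s s')
    (h' : Joined R g full v s' s'') (hW : w + v ≤ W) : Joined R g full (w + v) s s'' := by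
  obtain ⟨n, m, v1, v2, t, hv, h1, h2⟩ := h
  obtain ⟨n', m', u1, u2, t', hu, k1, k2⟩ := h'
  rcases le_total m n' with hm | hm
  · obtain ⟨k, rfl⟩ := Nat.exists_eq_add_of_le hm
    exact ⟨_, _, _, _, _, by omega, h1.comp (h2.det hc k1 (by omega)), k2⟩
  · obtain ⟨k, rfl⟩ := Nat.exists_eq_add_of_le hm
    exact ⟨_, _, _, _, _, by omega, h1, k2.comp (k1.det hc h2 (by omega))⟩

/-- The state `s` represents the point `q`. -/
def Rep (D : ConjData N L I) (g : L → P → P) (full : Prop) (q : P) (w : ℕ)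
    (s : L × N × LetterTerm N L P) : Prop :=
  Rel D g full w s.2.2 (pt (g s.1 (s.2.1⁻¹ • q)))

theorem rep_norm (hg : D.dual.IsModel g) {q : P} {w : ℕ} (l : L) (h : N)
    (e : LetterTerm N L P) :
    Rep D g full q w (norm D l h e) ↔ Rel D g full w e (pt (g l (h⁻¹ • q))) := by
  unfold Rep norm
  split_ifs with hl
  · rw [← Rel.smul_iff (D.τ h) (e := e), smul_pt]
    have := hg.slide (D.τ h) (h⁻¹ • q)
    simp only [ConjData.dual, MulEquiv.symm_apply_apply, smul_inv_smul] at this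
    rw [hl, this, inv_one, one_smul]
  · rfl

theorem Rep.near {q : P} {w v : ℕ} {s s' : L × N × LetterTerm N L P} (h : Rep D g full q v s)
    (hn : Near D g full w s s') : Rep D g full q (w + v) s' := by
  have := hn.2.2.symm.trans h
  rwa [hn.1, hn.2.1] at this

theorem Rep.up {W : ℕ} (hc : ∀ v < W, Cancels D g full v) (hf : full) (hg : D.dual.IsModel g)
    {q : P} {n w v : ℕ} {s s' : L × N × LetterTerm N L P} (h : Rep D g full q v s)
    (hu : Up R g full n w s s') (hW : w + v ≤ W) : Rep D g full q (w + v) s' := by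
  induction n generalizing w v s with
  | zero => exact h.near hu
  | succ n ih =>
    obtain ⟨i, e, v1, v2, hv, h1, h2, h3⟩ := hu
    obtain ⟨p, hp1, hp2⟩ := exists_hi_lo (full := full) R hf hg i (s.2.1⁻¹ • q)
    unfold Rep at h
    rw [h1] at h
    have h4 := ((h2.symm.trans (h.trans hp1.symm)).lo_of_hi (hc _ (by omega))).trans hp2
    rw [← rep_norm hg] at h4
    exact Rel.mono (by omega) (ih h4 h3 (by omega))

theorem Rep.down {W : ℕ} (hc : ∀ v < W, Cancels D g full v) (hf : full) (hg : D.dual.IsModel g)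
    {q : P} {n w v : ℕ} {s s' : L × N × LetterTerm N L P} (h : Rep D g full q v s')
    (hu : Up R g full n w s s') (hW : w + v ≤ W) : Rep D g full q (w + v) s := by
  induction n generalizing w v s with
  | zero => exact h.near hu.symm
  | succ n ih =>
    obtain ⟨i, e, v1, v2, hv, h1, h2, h3⟩ := hu
    obtain ⟨p, hp1, hp2⟩ := exists_hi_lo (full := full) R hf hg i (s.2.1⁻¹ • q)
    have h4 := ih h h3 (by omega)
    rw [rep_norm hg] at h4
    have h5 := ((h4.trans hp2.symm).hi_of_lo (hc _ (by omega))).trans hp1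
    unfold Rep
    rw [h1]
    exact (h2.trans h5).mono (by omega)

theorem Rep.joined {W : ℕ} (hc : ∀ v < W, Cancels D g full v) (hf : full) (hg : D.dual.IsModel g)
    {q : P} {w v : ℕ} {s s' : L × N × LetterTerm N L P} (h : Rep D g full q v s)
    (hj : Joined R g full w s s') (hW : w + v ≤ W) : Rep D g full q (w + v) s' := by
  obtain ⟨n, m, v1, v2, t, hv, h1, h2⟩ := hj
  exact Rel.mono (by omega) ((h.up hc hf hg h1 (by omega)).down hc hf hg h2 (by omega))

/-- The states attached to a term. -/
def HasState (D : ConjData N L I) (g : L → P → P) (full : Prop) :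
    LetterTerm N L P → L × N × LetterTerm N L P → Prop
  | pt q, s => full ∧ ∃ l h, s = norm D l h (pt (g l (h⁻¹ • q)))
  | app h l e, s => s = norm D l h e

theorem Rel.eq_pt (hf : ¬ full) {w : ℕ} {e e' : LetterTerm N L P} (h : Rel D g full w e e') :
    ∀ p, e = pt p ↔ e' = pt p := by
  induction h with
  | refl w e => simp
  | symm _ ih => exact fun p => (ih p).symm
  | trans _ _ ih ih' => exact fun p => (ih p).trans (ih' p)
  | glue w h l q hf' => exact absurd hf' hf
  | _ => simp

theorem joined_rest (R : D.Rooting) (h : N) (i : I) (e : LetterTerm N L P) :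
    Joined R g full 1 (norm D (D.a i) h (restA D i e)) (norm D (D.z i) h (restZ D i e)) := by
  have key : Joined R g full 1 (norm D (R.hi i) h (restHi R i e))
      (norm D (R.lo i) h (restLo R i e)) := by
    refine ⟨1, 0, 1, 0, _, le_rfl, ⟨i, e, 0, 0, le_rfl, norm_fst _ _ _, ?_, ?_⟩,
      near_norm _ _ (.refl _ _)⟩
    · rw [norm_of_ne (R.hi_ne i)]
      exact .refl _ _
    · rw [norm_of_ne (R.hi_ne i)]
      exact near_norm _ _ (.refl _ _)
  by_cases hi : R.flip i
  · simpa [restHi, restLo, hi, R.flip_spec] using key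
  · simpa [restHi, restLo, hi, R.not_flip_spec] using key.symm

theorem Joined.mono {w v : ℕ} (h : w ≤ v) {s s' : L × N × LetterTerm N L P}
    (hj : Joined R g full w s s') : Joined R g full v s s' := by
  obtain ⟨n, m, v1, v2, t, hv, h1, h2⟩ := hj
  exact ⟨n, m, v1, v2, t, by omega, h1, h2⟩

theorem Rel.joined_or_rep [Nonempty L] {W : ℕ} (R : D.Rooting)
    (hc : ∀ v < W, Cancels D g full v)
    (hg : full → D.dual.IsModel g) {w : ℕ} {e e' : LetterTerm N L P} (h : Rel D g full w e e')
    (hW : w ≤ W) {s s' : L × N × LetterTerm N L P} (hs : HasState D g full e s)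
    (hs' : HasState D g full e' s') :
    Joined R g full w s s' ∨
      full ∧ ∃ q v v', v + v' ≤ w ∧ Rep D g full q v s ∧ Rep D g full q v' s' := by
  have hpt : full → ∀ q s, HasState D g full (pt q) s → Rep D g full q 0 s := by
    rintro hf q _ ⟨_, l, h, rfl⟩
    exact (rep_norm (hg hf) _ _ _).2 (.refl _ _)
  induction h generalizing s s' with
  | refl w e =>
    cases e with
    | pt q => exact .inr ⟨hs.1, q, 0, 0, by omega, hpt hs.1 _ _ hs, hpt hs.1 _ _ hs'⟩
    | app h l e =>
      cases hs
      cases hs'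
      exact .inl ⟨0, 0, 0, 0, _, by omega, near_norm _ _ (.refl _ _), near_norm _ _ (.refl _ _)⟩
  | symm _ ih =>
    rcases ih hW hs' hs with h | ⟨hf, q, v, v', hv, h1, h2⟩
    · exact .inl h.symm
    · exact .inr ⟨hf, q, v', v, by omega, h2, h1⟩
  | @trans w v e e' e'' h1 h2 ih1 ih2 =>
    obtain ⟨t, ht⟩ : ∃ t, HasState D g full e' t := by
      cases e' with
      | app h l e => exact ⟨_, rfl⟩
      | pt q =>
        by_cases hf : full
        · exact ⟨_, hf, Classical.arbitrary L, 1, rfl⟩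
        · rw [(h1.eq_pt hf q).2 rfl] at hs
          exact absurd hs.1 hf
    rcases ih1 (by omega) hs ht with j1 | ⟨hf, q, v1, v1', hv1, r1, r1'⟩ <;>
    rcases ih2 (by omega) ht hs' with j2 | ⟨hf, q', v2, v2', hv2, r2, r2'⟩
    · exact .inl (j1.trans hc j2 hW)
    · exact .inr ⟨hf, q', _, _, by omega, r2.joined hc hf (hg hf) j1.symm (by omega), r2'⟩
    · exact .inr ⟨hf, q, _, _, by omega, r1, r1'.joined hc hf (hg hf) j2 (by omega)⟩
    · have := (r1'.symm.trans r2).pt_inj hg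
      obtain rfl : q = q' := by simpa using (hg hf).inj _ this
      exact .inr ⟨hf, q, v1, v2', by omega, r1, r2'⟩
  | congr h l h1 _ =>
    cases hs
    cases hs'
    exact .inl ⟨0, 0, _, 0, _, by omega, near_norm _ _ h1, near_norm _ _ (.refl _ _)⟩
  | glue w h l q hf =>
    refine .inr ⟨hf, h • q, 0, 0, by omega, ?_, hpt hf _ _ hs'⟩
    cases hs
    rw [rep_norm (hg hf), inv_smul_smul]
    exact .refl _ _
  | slide w h e =>
    obtain rfl : s = s' := by
      cases hs
      cases hs'
      simp [norm]
    exact .inl ⟨0, 0, 0, 0, s, by omega, ⟨rfl, rfl, .refl _ _⟩, ⟨rfl, rfl, .refl _ _⟩⟩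
  | square w h i e hi =>
    have := joined_rest (g := g) (full := full) R h i e
    simp only [LetterTerm.restA, LetterTerm.restZ, hi, if_false] at this
    cases hs
    cases hs'
    exact .inl (this.mono (by omega))
  | triangle w h i e hi =>
    have := joined_rest (g := g) (full := full) R h i e
    simp only [LetterTerm.restA, LetterTerm.restZ, hi, if_true] at this
    cases hs
    cases hs'
    exact .inl (this.mono (by omega))

theorem cancels (R : D.Rooting) (hg : full → D.dual.IsModel g) (W : ℕ) :
    Cancels D g full W := by
  induction W using Nat.strong_induction_on with
  | _ W hc =>
    intro h l e e' hr
    have : Nonempty L := ⟨l⟩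
    rw [← rel_norm l h]
    rcases hr.joined_or_rep R hc hg le_rfl rfl rfl with ⟨n, m, v, v', t, hv, h1, h2⟩ |
      ⟨-, q, v, v', hv, h1, h2⟩
    · exact (h1.rel_of_near_tags hc h2 (by simp) (norm_snd_fst _ _ _ _) hv).mono hv
    · unfold Rep at h1 h2
      rw [norm_fst, norm_snd_fst _ _ _ e] at h2
      rw [norm_fst] at h1
      exact (h1.trans h2.symm).mono hv

/-- The setoid of equivalence of terms. -/
def setoid (D : ConjData N L I) (g : L → P → P) (full : Prop) : Setoid (LetterTerm N L P) where
  r e e' := ∃ w, Rel D g full w e e'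
  iseqv := ⟨fun _ => ⟨0, .refl _ _⟩, fun ⟨w, h⟩ => ⟨w, h.symm⟩,
    fun ⟨_, h⟩ ⟨_, h'⟩ => ⟨_, h.trans h'⟩⟩

instance (D : ConjData N L I) (g : L → P → P) (full : Prop) :
    MulAction N (Quotient (setoid D g full)) where
  smul n := Quotient.map (n • ·) fun _ _ ⟨w, h⟩ => ⟨w, h.smul n⟩
  one_smul x := by
    induction x using Quotient.inductionOn with
    | _ e => exact congrArg _ (one_smul N e)
  mul_smul m n x := by
    induction x using Quotient.inductionOn with
    | _ e => exact congrArg _ (mul_smul m n e)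

end LetterTerm

open LetterTerm in
/-- A partial model, whose letters only act backwards, embeds into a model. -/
theorem ConjData.exists_model {N L I P : Type} [Group N] [MulAction N P] {D : ConjData N L I}
    (R : D.Rooting) (full : Prop) (g : L → P → P) (hg : full → D.dual.IsModel g) :
    ∃ (X : Type) (_ : MulAction N X) (f : L → X → X) (ι : P → X), D.IsModel f ∧
      Function.Injective ι ∧ (∀ (n : N) p, ι (n • p) = n • ι p) ∧
      (full → ∀ l q, f l (ι (g l q)) = ι q) := by
  refine ⟨Quotient (setoid D g full), inferInstance,
    fun l => Quotient.map (app 1 l) fun _ _ ⟨w, h⟩ => ⟨w, h.congr 1 l⟩,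
    fun p => Quotient.mk _ (pt p), ⟨?_, ?_, ?_, ?_⟩, ?_, ?_, ?_⟩
  · intro l x y
    induction x, y using Quotient.inductionOn₂ with
    | _ e e' =>
      intro h
      obtain ⟨w, h⟩ := Quotient.exact h
      exact Quotient.sound ⟨w, cancels R hg w _ _ _ _ h⟩
  · intro n x
    induction x using Quotient.inductionOn with
    | _ e => exact Quotient.sound ⟨0, by simpa using Rel.slide 0 n e⟩
  · intro i hi x
    induction x using Quotient.inductionOn with
    | _ e => exact Quotient.sound ⟨1, by simpa using Rel.square 0 1 i e hi⟩
  · intro i hi x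
    induction x using Quotient.inductionOn with
    | _ e => exact Quotient.sound ⟨1, by simpa using Rel.triangle 0 1 i e hi⟩
  · intro p q h
    obtain ⟨w, h⟩ := Quotient.exact h
    exact h.pt_inj hg
  · intro n p
    rfl
  · intro hf l q
    exact Quotient.sound ⟨0, by simpa using Rel.glue (D := D) (g := g) 0 1 l q hf⟩

namespace ConjData

variable {N L I : Type} [Group N]

/-- A set with an action of `N` and a model of `D` on it. -/
structure Stage (D : ConjData N L I) where
  X : Type
  act : MulAction N X
  f : L → X → X
  model : D.IsModel f

attribute [instance] Stage.act

/-- An embedding of models whose image lies in the range of every letter. -/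
structure IsExtension {D : ConjData N L I} (S T : D.Stage) (ι : S.X → T.X) : Prop where
  inj : Function.Injective ι
  smul : ∀ (n : N) x, ι (n • x) = n • ι x
  comm : ∀ l x, ι (S.f l x) = T.f l (ι x)
  range : ∀ l x, ∃ y, T.f l y = ι x

theorem Stage.exists_extension {D : ConjData N L I} (R : D.Rooting) (R' : D.dual.Rooting)
    (S : D.Stage) : ∃ (T : D.Stage) (ι : S.X → T.X), IsExtension S T ι := by
  obtain ⟨X, _, f, ι, hf, hι, hs, hc⟩ := exists_model R' True S.f fun _ => S.model.dual_dual
  obtain ⟨Y, _, f', ι', hf', hι', hs', hc'⟩ := exists_model R True f fun _ => hf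
  refine ⟨⟨Y, _, f', hf'⟩, ι' ∘ ι, hι'.comp hι, ?_, ?_, ?_⟩
  · intro n x
    simp [hs, hs']
  · intro l x
    have h := hc' trivial l (ι (S.f l x))
    rw [hc trivial] at h
    exact h.symm
  · exact fun l x => ⟨_, hc' trivial l (ι x)⟩

section Limit

variable {D : ConjData N L I} (S : ℕ → D.Stage) (ι : ∀ k, (S k).X → (S (k + 1)).X)

/-- Sequences of points which are eventually coherent. -/
abbrev CoherentSeq : Type := {s : ∀ k, (S k).X // ∃ K, ∀ k ≥ K, s (k + 1) = ι k (s k)}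

/-- Eventual equality of sequences. -/
instance limitSetoid : Setoid (CoherentSeq S ι) where
  r s t := ∃ K, ∀ k ≥ K, s.1 k = t.1 k
  iseqv := ⟨fun _ => ⟨0, fun _ _ => rfl⟩, fun ⟨K, h⟩ => ⟨K, fun k hk => (h k hk).symm⟩,
    fun ⟨K, h⟩ ⟨K', h'⟩ => ⟨max K K', fun k hk =>
      (h k (le_of_max_le_left hk)).trans (h' k (le_of_max_le_right hk))⟩⟩

/-- The direct limit of a sequence of models. -/
abbrev Limit : Type := Quotient (limitSetoid S ι)

/-- Maps commuting with the transition maps act on the limit. -/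
def limitMap (m : ∀ k, (S k).X → (S k).X) (hm : ∀ k x, ι k (m k x) = m (k + 1) (ι k x)) :
    Limit S ι → Limit S ι :=
  Quotient.map (fun s => ⟨fun k => m k (s.1 k), s.2.imp fun K h k hk => by simp only [h k hk, hm]⟩)
    fun _ _ ⟨K, h⟩ => ⟨K, fun k hk => congrArg (m k) (h k hk)⟩

variable {S ι}

/-- The action of `N` on the limit. -/
abbrev limitAction (h : ∀ k, IsExtension (S k) (S (k + 1)) (ι k)) : MulAction N (Limit S ι) where
  smul n := limitMap S ι (fun k x => n • x) fun k => (h k).smul n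
  one_smul x := by
    induction x using Quotient.inductionOn
    exact Quotient.sound ⟨0, fun k _ => one_smul N _⟩
  mul_smul m n x := by
    induction x using Quotient.inductionOn
    exact Quotient.sound ⟨0, fun k _ => mul_smul m n _⟩

theorem exists_limit (h : ∀ k, IsExtension (S k) (S (k + 1)) (ι k)) (x₀ : (S 0).X)
    (hx₀ : ∀ n : N, n • x₀ = x₀ → n = 1) :
    ∃ (Ω : Type) (_ : MulAction N Ω) (F : L → Equiv.Perm Ω), D.IsModel (fun l => F l) ∧
      ∃ x : Ω, ∀ n : N, n • x = x → n = 1 := by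
  classical
  let u : ∀ k, (S k).X := fun k => Nat.rec x₀ (fun k x => ι k x) k
  let := limitAction h
  let f : L → Limit S ι → Limit S ι := fun l =>
    limitMap S ι (fun k => (S k).f l) fun k => (h k).comm l
  have hinj : ∀ l, Function.Injective (f l) := by
    intro l x y
    induction x, y using Quotient.inductionOn₂ with
    | _ s t =>
      intro hst
      obtain ⟨K, hK⟩ := Quotient.exact hst
      exact Quotient.sound ⟨K, fun k hk => (S k).model.inj l (hK k hk)⟩
  have hsurj : ∀ l, Function.Surjective (f l) := by
    intro l y
    induction y using Quotient.inductionOn with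
    | _ s =>
      obtain ⟨K, hK⟩ := s.2
      let t : ∀ k, (S k).X := fun k =>
        if hy : ∃ y, (S k).f l y = s.1 k then hy.choose else u k
      have ht : ∀ k ≥ K + 1, (S k).f l (t k) = s.1 k := by
        intro k hk
        have hy : ∃ y, (S k).f l y = s.1 k := by
          obtain ⟨k, rfl⟩ : ∃ j, k = j + 1 := ⟨k - 1, by omega⟩
          rw [hK k (by omega)]
          exact (h k).range l _
        simp only [t, hy, dif_pos]
        exact hy.choose_spec
      refine ⟨Quotient.mk _ ⟨t, K + 1, fun k hk => (S (k + 1)).model.inj l ?_⟩, ?_⟩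
      · rw [ht _ (by omega), hK k (by omega), ← (h k).comm, ht k hk]
      · exact Quotient.sound ⟨K + 1, ht⟩
  refine ⟨Limit S ι, inferInstance, fun l => Equiv.ofBijective (f l) ⟨hinj l, hsurj l⟩,
    ⟨fun l => hinj l, ?_, ?_, ?_⟩, Quotient.mk _ ⟨u, 0, fun k _ => rfl⟩, ?_⟩
  · intro n x
    induction x using Quotient.inductionOn
    exact Quotient.sound ⟨0, fun k _ => (S k).model.slide n _⟩
  · intro i hi x
    induction x using Quotient.inductionOn
    exact Quotient.sound ⟨0, fun k _ => (S k).model.square i hi _⟩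
  · intro i hi x
    induction x using Quotient.inductionOn
    exact Quotient.sound ⟨0, fun k _ => (S k).model.triangle i hi _⟩
  · intro n hn
    obtain ⟨K, hK⟩ := Quotient.exact hn
    have key : ∀ k, n • u k = u k → n • x₀ = x₀ := by
      intro k
      induction k with
      | zero => exact id
      | succ k ih => exact fun hk => ih ((h k).inj (((h k).smul n _).trans hk))
    exact hx₀ n (key K (hK K le_rfl))

end Limit

/-- If both orientations of the relations admit rank functions, then there is an action of `N` with
a free orbit, extended by permutations satisfying the relations. -/
theorem exists_perm_model (D : ConjData N L I) (hz : Function.Injective D.z) (ra rb : L → ℕ)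
    (hra : ∀ i, ra (D.a i) < ra (D.z i)) (hrb : ∀ i, rb (D.b i) < rb (D.z i)) :
    ∃ (Ω : Type) (_ : MulAction N Ω) (F : L → Equiv.Perm Ω), D.IsModel (fun l => F l) ∧
      ∃ x : Ω, ∀ n : N, n • x = x → n = 1 := by
  obtain ⟨R⟩ := D.nonempty_rooting hz ra hra
  obtain ⟨R'⟩ := D.dual.nonempty_rooting hz rb hrb
  obtain ⟨X, _, f, ι, hf, hι, hs, -⟩ := exists_model (P := N) R False (fun _ x => x) False.elim
  choose next ε hε using Stage.exists_extension R R'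
  refine exists_limit (S := fun k => Nat.rec ⟨X, _, f, hf⟩ (fun _ S => next S) k)
    (ι := fun k => ε _) (fun k => hε _) (ι 1) fun n hn => ?_
  change n • ι 1 = ι 1 at hn
  rw [← hs] at hn
  simpa using hι hn

end ConjData

/-- A homomorphism on the kernel of a surjection onto `ℤ` extends to the whole group, provided that
a compatible image of an element of degree one is given. -/
theorem MonoidHom.exists_extend_of_ker {A M : Type} [Group A] [Group M]
    (d : A →* Multiplicative ℤ) (t : A) (ht : d t = Multiplicative.ofAdd 1) (ψ : d.ker →* M)
    (F : M) (hF : ∀ n, ψ n * F = F * ψ (MulAut.conjNormal t⁻¹ n)) :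
    ∃ Ψ : A →* M, (∀ n : d.ker, Ψ n = ψ n) ∧ Ψ t = F := by
  have hF' : ∀ n, F * ψ n = ψ (MulAut.conjNormal t n) * F := fun n => by
    rw [hF, ← MulAut.mul_apply, ← map_mul, inv_mul_cancel, map_one, MulAut.one_apply]
  have hz : ∀ (k : ℤ) n, F ^ k * ψ n = ψ (MulAut.conjNormal (t ^ k) n) * F ^ k := by
    intro k
    induction k with
    | zero => simp
    | succ k ih =>
      intro n
      rw [zpow_add_one, zpow_add_one, mul_assoc, hF', ← mul_assoc, ih, mul_assoc, map_mul,
        MulAut.mul_apply]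
    | pred k ih =>
      intro n
      have h : F⁻¹ * ψ n = ψ (MulAut.conjNormal t⁻¹ n) * F⁻¹ := by
        rw [eq_mul_inv_iff_mul_eq, mul_assoc, hF, inv_mul_cancel_left]
      rw [zpow_sub_one, zpow_sub_one, mul_assoc, h, ← mul_assoc, ih, mul_assoc, map_mul,
        MulAut.mul_apply]
  have hker : ∀ h : A, h * t ^ (-(d h).toAdd) ∈ d.ker := by
    intro h
    rw [MonoidHom.mem_ker, map_mul, map_zpow, ht]
    apply Multiplicative.toAdd.injective
    simp
  refine ⟨MonoidHom.mk' (fun h => ψ ⟨_, hker h⟩ * F ^ (d h).toAdd) fun h h' => ?_, ?_, ?_⟩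
  · have : (⟨_, hker (h * h')⟩ : d.ker) = ⟨_, hker h⟩ *
        MulAut.conjNormal (t ^ (d h).toAdd) ⟨_, hker h'⟩ := by
      ext
      simp only [map_mul, toAdd_mul, Subgroup.coe_mul, MulAut.conjNormal_apply]
      group
    rw [this, map_mul, map_mul, toAdd_mul, zpow_add, mul_assoc, ← mul_assoc _ (F ^ _) (F ^ _),
      ← hz]
    group
  · rintro ⟨n, hn⟩
    have hn' : d n = 1 := hn
    simp [hn']
  · have : (⟨_, hker t⟩ : d.ker) = 1 := by
      ext
      simp [ht]
    simp only [MonoidHom.mk'_apply, this]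
    simp [ht]

/-- `x` or its inverse. -/
noncomputable def signed {M : Type} [Group M] (p : Prop) (x : M) : M :=
  open Classical in if p then x else x⁻¹

theorem signed_signed {M : Type} [Group M] (p : Prop) (x : M) : signed p (signed p x) = x := by
  unfold signed; split_ifs <;> simp

theorem map_signed {M M' : Type} [Group M] [Group M'] (f : M →* M') (p : Prop) (x : M) :
    f (signed p x) = signed p (f x) := by
  unfold signed; split_ifs <;> simp

theorem MonoidHom.exists_extend_of_ker_signed {A M : Type} [Group A] [Group M]
    (d : A →* Multiplicative ℤ) (t : A) (p : Prop) (ht : d t = Multiplicative.ofAdd 1)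
    (ψ : d.ker →* M) (F : M)
    (hF : ∀ n, ψ n * F = F * ψ (MulAut.conjNormal (signed p t)⁻¹ n)) :
    ∃ Ψ : A →* M, (∀ n : d.ker, Ψ n = ψ n) ∧ Ψ (signed p t) = F := by
  by_cases hp : p
  · simp only [signed, hp, if_true] at hF ⊢
    exact exists_extend_of_ker d t ht ψ F hF
  · simp only [signed, hp, if_false] at hF ⊢
    obtain ⟨Ψ, h1, h2⟩ := exists_extend_of_ker d t ht ψ F⁻¹ fun n => by
      have := hF (MulAut.conjNormal t⁻¹ n)
      rw [← MulAut.mul_apply, ← map_mul, inv_inv, mul_inv_cancel, map_one,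
        MulAut.one_apply] at this
      rw [mul_inv_eq_iff_eq_mul, mul_assoc, this, inv_mul_cancel_left]
    exact ⟨Ψ, h1, by simp [h2]⟩

namespace LOG

variable {V E A : Type} [Group A]

/-- The group element at a vertex `v`: a prescribed element if `v = o`, a new one otherwise. -/
noncomputable def place {B : Type} (o : V) (g : V → B) (v : V) (x : B) : B :=
  open Classical in if v = o then x else g v

/-- The relations of the edges in `ES`, where the vertex `o` is replaced by given elements of `A`,
can be solved in a group containing `A`. -/
def Solvable (G : LOG V E) (ES : Finset E) (o : V) (deg : A →* Multiplicative ℤ)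
    (x y z : E → A) : Prop :=
  ∃ (B : Type) (_ : Group B) (θ : A →* B) (d : B →* Multiplicative ℤ) (g : V → B),
    Function.Injective θ ∧ (∀ a, d (θ a) = deg a) ∧ (∀ v, d (g v) = Multiplicative.ofAdd 1) ∧
    ∀ e ∈ ES, place o g (G.init e) (θ (x e)) * place o g (G.label e) (θ (z e)) =
      place o g (G.label e) (θ (z e)) * place o g (G.term e) (θ (y e))

theorem solvable_empty (G : LOG V E) (o : V) (deg : A →* Multiplicative ℤ) (x y z : E → A) :
    G.Solvable ∅ o deg x y z :=
  ⟨A × Multiplicative ℤ, inferInstance, (MonoidHom.id A).prod deg, MonoidHom.snd _ _,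
    fun _ => (1, Multiplicative.ofAdd 1), fun _ _ h => congrArg Prod.fst h, fun _ => rfl,
    fun _ => rfl, by simp⟩

/-- Signs of the letters in `a ζ = ζ b`. -/
theorem signed_relation {M : Type} [Group M] {p q s : Prop} {α β ζ : M}
    (h1 : (p ↔ q) → α * ζ = ζ * β) (h2 : ¬ (p ↔ q) → α * ζ * β = ζ) :
    (s → signed p α * signed s ζ = signed s ζ * signed q β) ∧
      (¬ s → signed q β * signed s ζ = signed s ζ * signed p α) := by
  have key : signed p α * ζ = ζ * signed q β := by
    by_cases hp : p <;> by_cases hq : q <;> simp only [signed, hp, hq, if_true, if_false]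
    · exact h1 (by tauto)
    · rw [eq_mul_inv_iff_mul_eq]
      exact h2 (by tauto)
    · rw [inv_mul_eq_iff_eq_mul, ← mul_assoc]
      exact (h2 (by tauto)).symm
    · rw [inv_mul_eq_iff_eq_mul, ← mul_assoc, eq_mul_inv_iff_mul_eq]
      exact (h1 (by tauto)).symm
  constructor
  · intro hs
    simpa [signed, hs] using key
  · intro hs
    simp only [signed, hs, if_false] at key ⊢
    rw [mul_inv_eq_iff_eq_mul, mul_assoc, eq_inv_mul_iff_mul_eq]
    exact key.symm

theorem solvable_of_ranks (G : LOG V E) (ES : Finset E) (hl : Set.InjOn G.label ES) (o : V)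
    (deg : A →* Multiplicative ℤ) (x y z : E → A)
    (hx : ∀ e, deg (x e) = Multiplicative.ofAdd 1) (hy : ∀ e, deg (y e) = Multiplicative.ofAdd 1)
    (hz : ∀ e, deg (z e) = Multiplicative.ofAdd 1) (s : E → Prop) (ra rb : V → ℕ)
    (hs : ∀ e ∈ ES, s e → ra (G.init e) < ra (G.label e) ∧ rb (G.term e) < rb (G.label e))
    (hs' : ∀ e ∈ ES, ¬ s e → ra (G.term e) < ra (G.label e) ∧ rb (G.init e) < rb (G.label e)) :
    G.Solvable ES o deg x y z := by
  classical
  rcases ES.eq_empty_or_nonempty with rfl | ⟨e₀, he₀⟩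
  · exact solvable_empty G o deg x y z
  let pos : V → Prop := fun v => ∀ e ∈ ES, G.label e = v → s e
  have hpos : ∀ e ∈ ES, (pos (G.label e) ↔ s e) := fun e he =>
    ⟨fun h => h e he rfl, fun h e' he' hh => hl he' he hh ▸ h⟩
  obtain ⟨t, ht, htz⟩ : ∃ t, deg t = Multiplicative.ofAdd 1 ∧
      ∀ e ∈ ES, G.label e = o → z e = t := by
    by_cases h : ∃ e ∈ ES, G.label e = o
    · obtain ⟨e, he, rfl⟩ := h
      exact ⟨z e, hz e, fun e' he' h => by rw [hl he' he h]⟩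
    · exact ⟨z e₀, hz e₀, fun e he h' => absurd ⟨e, he, h'⟩ h⟩
  have hker : ∀ u : A, deg u = Multiplicative.ofAdd 1 →
      (signed (pos o) t)⁻¹ * signed (pos o) u ∈ deg.ker ∧
      signed (pos o) u * (signed (pos o) t)⁻¹ ∈ deg.ker := by
    intro u hu
    simp [MonoidHom.mem_ker, map_signed, ht, hu]
  let D : ConjData deg.ker V {e // e ∈ ES} :=
    { o := o
      τ := MulAut.conjNormal (signed (pos o) t)⁻¹
      z := fun e => G.label e
      a := fun e => if s e then G.init e else G.term e
      b := fun e => if s e then G.term e else G.init e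
      ν := fun e => if (if s e then G.init e else G.term e) = o then
        ⟨_, (hker (if s e then x e else y e) (by split_ifs <;> simp [hx, hy])).1⟩ else 1
      μ := fun e => if (if s e then G.term e else G.init e) = o then
        ⟨_, (hker (if s e then y e else x e) (by split_ifs <;> simp [hx, hy])).2⟩ else 1
      twisted := fun e => ¬ (pos (if s e then G.init e else G.term e) ↔
        pos (if s e then G.term e else G.init e)) }
  obtain ⟨Ω, _, F, hF, ω, hω⟩ := D.exists_perm_model
    (fun e e' h => Subtype.ext (hl e.2 e'.2 h)) ra rb
    (by
      rintro ⟨e, he⟩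
      by_cases h : s e
      · simpa [D, h] using (hs e he h).1
      · simpa [D, h] using (hs' e he h).1)
    (by
      rintro ⟨e, he⟩
      by_cases h : s e
      · simpa [D, h] using (hs e he h).2
      · simpa [D, h] using (hs' e he h).2)
  let ψ : deg.ker →* Equiv.Perm Ω := MulAction.toPermHom _ _
  obtain ⟨Ψ, hΨ, hΨt⟩ := MonoidHom.exists_extend_of_ker_signed deg t (pos o) ht ψ (F o)
    fun n => Equiv.ext fun u => hF.slide n u
  let g : V → Equiv.Perm Ω := fun v => signed (pos v) (F v)
  have ha : ∀ (v : V) (u : A) (hu : deg u = Multiplicative.ofAdd 1), place o g v (Ψ u) =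
      signed (pos v) (F v * ψ (if v = o then ⟨_, (hker u hu).1⟩ else 1)) := by
    intro v u hu
    by_cases hv : v = o
    · subst hv
      simp only [place, if_true]
      rw [← hΨ, ← hΨt, ← map_mul, mul_inv_cancel_left, map_signed, signed_signed]
    · simp [place, hv, g]
  have hb : ∀ (v : V) (u : A) (hu : deg u = Multiplicative.ofAdd 1), place o g v (Ψ u) =
      signed (pos v) (ψ (if v = o then ⟨_, (hker u hu).2⟩ else 1) * F v) := by
    intro v u hu
    by_cases hv : v = o
    · subst hv
      simp only [place, if_true]
      rw [← hΨ, ← hΨt, ← map_mul, inv_mul_cancel_right, map_signed, signed_signed]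
    · simp [place, hv, g]
  have hzz : ∀ e ∈ ES, place o g (G.label e) (Ψ (z e)) = signed (s e) (F (G.label e)) := by
    intro e he
    by_cases hv : G.label e = o
    · rw [htz e he hv]
      simp only [place, hv, if_true]
      have h1 := hpos e he
      rw [hv] at h1
      rw [← hΨt, ← propext h1, map_signed, signed_signed]
    · simp [place, hv, g, hpos e he]
  have main : ∀ e ∈ ES, place o g (G.init e) (Ψ (x e)) * place o g (G.label e) (Ψ (z e)) =
      place o g (G.label e) (Ψ (z e)) * place o g (G.term e) (Ψ (y e)) := by
    intro e he
    let i : {e // e ∈ ES} := ⟨e, he⟩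
    have h1 : ¬ D.twisted i → F (D.a i) * ψ (D.ν i) * F (D.z i) =
        F (D.z i) * (ψ (D.μ i) * F (D.b i)) := fun h => Equiv.ext (hF.square i h)
    have h2 : D.twisted i → F (D.a i) * ψ (D.ν i) * F (D.z i) * (ψ (D.μ i) * F (D.b i)) =
        F (D.z i) := fun h => Equiv.ext (hF.triangle i h)
    obtain ⟨r1, r2⟩ := signed_relation (p := pos (D.a i)) (q := pos (D.b i)) (s := s e)
      (fun h => h1 (not_not_intro h)) h2
    rw [hzz e he]
    by_cases hse : s e
    · rw [ha _ _ (hx e), hb _ _ (hy e)]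
      simpa [D, i, hse] using r1 hse
    · rw [hb _ _ (hx e), ha _ _ (hy e)]
      simpa [D, i, hse] using r2 hse
  refine ⟨Equiv.Perm Ω × Multiplicative ℤ, inferInstance, Ψ.prod deg, MonoidHom.snd _ _,
    fun v => (g v, Multiplicative.ofAdd 1), ?_, fun _ => rfl, fun _ => rfl, ?_⟩
  · rw [injective_iff_map_eq_one]
    intro a h
    have h1 : deg a = 1 := congrArg Prod.snd h
    have h2 : Ψ a = 1 := congrArg Prod.fst h
    have h3 := hΨ ⟨a, h1⟩
    rw [h2] at h3
    have h4 := hω ⟨a, h1⟩ (by simpa [ψ] using congrArg (fun f : Equiv.Perm Ω => f ω) h3.symm)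
    simpa using congrArg Subtype.val h4
  · intro e he
    have hp : ∀ (v : V) (u : A), deg u = Multiplicative.ofAdd 1 →
        place o (fun v => (g v, Multiplicative.ofAdd (1 : ℤ))) v (Ψ.prod deg u) =
        (place o g v (Ψ u), Multiplicative.ofAdd 1) := by
      intro v u hu
      by_cases hv : v = o <;> simp [place, hv, hu]
    rw [hp _ _ (hx e), hp _ _ (hy e), hp _ _ (hz e)]
    exact Prod.ext (main e he) rfl

end LOG

section Arborescence

variable {V α : Type} [DecidableEq V] (tail head : α → V)

/-- The number of arcs in `R` leaving `W`. -/
def outDeg (R : Finset α) (W : Finset V) : ℕ := (R.filter fun t => tail t ∈ W ∧ head t ∉ W).card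

variable {tail head}

theorem outDeg_inter_add_union (R : Finset α) (W W' : Finset V) :
    outDeg tail head R (W ∩ W') + outDeg tail head R (W ∪ W') ≤
      outDeg tail head R W + outDeg tail head R W' := by
  simp only [outDeg, Finset.card_filter, ← Finset.sum_add_distrib]
  refine Finset.sum_le_sum fun t _ => ?_
  simp only [Finset.mem_inter, Finset.mem_union]
  by_cases h1 : tail t ∈ W <;> by_cases h2 : tail t ∈ W' <;> by_cases h3 : head t ∈ W <;>
    by_cases h4 : head t ∈ W' <;> simp [h1, h2, h3, h4]

theorem exists_mem_of_outDeg_pos {R : Finset α} {W : Finset V} (h : 0 < outDeg tail head R W) :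
    ∃ t ∈ R, tail t ∈ W ∧ head t ∉ W := by
  obtain ⟨t, ht⟩ := Finset.card_pos.1 h
  exact ⟨t, (Finset.mem_filter.1 ht).1, (Finset.mem_filter.1 ht).2⟩

/-- An in-arborescence exists as soon as every set avoiding the root has an outgoing arc. -/
theorem exists_rank_of_outDeg_pos {R : Finset α} {VS : Finset V} {ρ : V} (hρ : ρ ∈ VS)
    (hh : ∀ t ∈ R, head t ∈ VS)
    (hR : ∀ W ⊆ VS, ρ ∉ W → W.Nonempty → 1 ≤ outDeg tail head R W) :
    ∃ r : V → ℕ, ∀ v ∈ VS, v ≠ ρ → ∃ t ∈ R, tail t = v ∧ r (head t) < r v := by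
  have key : ∀ n < VS.card, ∃ S ⊆ VS, ρ ∈ S ∧ S.card = n + 1 ∧ ∃ r : V → ℕ,
      ∀ v ∈ S, v ≠ ρ → ∃ t ∈ R, tail t = v ∧ head t ∈ S ∧ r (head t) < r v := by
    intro n
    induction n with
    | zero =>
      intro _
      refine ⟨{ρ}, by simpa using hρ, by simp, by simp, fun _ => 0, fun v hv hv' => ?_⟩
      exact absurd (Finset.mem_singleton.1 hv) hv'
    | succ n ih =>
      intro hn
      obtain ⟨S, hS, hρS, hcard, r, hr⟩ := ih (by omega)
      have hne : (VS \ S).Nonempty := by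
        rw [← Finset.card_pos, Finset.card_sdiff_of_subset hS]
        omega
      obtain ⟨t, ht, ht1, ht2⟩ := exists_mem_of_outDeg_pos
        (hR (VS \ S) Finset.sdiff_subset (by simp [hρS]) hne)
      have htS : head t ∈ S := by
        have := hh t ht
        simpa [this] using ht2
      rw [Finset.mem_sdiff] at ht1
      refine ⟨insert (tail t) S, Finset.insert_subset ht1.1 hS, by simp [hρS],
        by rw [Finset.card_insert_of_notMem ht1.2, hcard],
        Function.update r (tail t) (r (head t) + 1), ?_⟩
      intro v hv hvρ
      rcases Finset.mem_insert.1 hv with rfl | hv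
      · refine ⟨t, ht, rfl, by simp [htS], ?_⟩
        have : head t ≠ tail t := fun h => ht1.2 (h ▸ htS)
        simp [this]
      · obtain ⟨u, hu, rfl, hu1, hu2⟩ := hr v hv hvρ
        refine ⟨u, hu, rfl, by simp [hu1], ?_⟩
        have h1 : head u ≠ tail t := fun h => ht1.2 (h ▸ hu1)
        have h2 : tail u ≠ tail t := fun h => ht1.2 (h ▸ hv)
        simpa [h1, h2] using hu2
  obtain ⟨S, hS, -, hcard, r, hr⟩ := key (VS.card - 1) (by
    have := Finset.card_pos.2 ⟨ρ, hρ⟩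
    omega)
  have : S = VS := Finset.eq_of_subset_of_card_le hS (by omega)
  subst this
  exact ⟨r, fun v hv hvρ => (hr v hv hvρ).imp fun t h => ⟨h.1, h.2.1, h.2.2.2⟩⟩

variable [DecidableEq α]

theorem outDeg_erase_of_not {R : Finset α} {W : Finset V} {t : α}
    (h : ¬ (tail t ∈ W ∧ head t ∉ W)) : outDeg tail head (R.erase t) W = outDeg tail head R W := by
  unfold outDeg
  rw [Finset.filter_erase, Finset.erase_eq_of_notMem]
  simp only [Finset.mem_filter]
  tauto

theorem outDeg_le_outDeg_erase_add_one (R : Finset α) (W : Finset V) (t : α) :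
    outDeg tail head R W ≤ outDeg tail head (R.erase t) W + 1 := by
  unfold outDeg
  rw [Finset.filter_erase]
  exact Nat.sub_le_iff_le_add.1 Finset.pred_card_le_card_erase

/-- One step of Lovász's proof of Edmonds' theorem on disjoint arborescences: a partial
arborescence on `S` can be enlarged, keeping the remaining arcs connected to the root. -/
theorem exists_arc_of_two_le_outDeg {R₀ R : Finset α} {VS S : Finset V} {ρ : V} (hS : S ⊂ VS)
    (hρ : ρ ∈ S) (hh : ∀ t ∈ R₀, head t ∈ VS)
    (hR₀ : ∀ W ⊆ VS, ρ ∉ W → W.Nonempty → 2 ≤ outDeg tail head R₀ W)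
    (hRS : ∀ t ∈ R₀, tail t ∉ S → t ∈ R)
    (hR : ∀ W ⊆ VS, ρ ∉ W → W.Nonempty → 1 ≤ outDeg tail head R W) :
    ∃ t ∈ R₀, tail t ∈ VS ∧ tail t ∉ S ∧ head t ∈ S ∧
      ∀ W ⊆ VS, ρ ∉ W → W.Nonempty → 1 ≤ outDeg tail head (R.erase t) W := by
  by_cases hcrit : ∃ W ⊆ VS, ρ ∉ W ∧ outDeg tail head R W = 1 ∧ ¬ W ⊆ S
  · obtain ⟨W, ⟨hW, hρW, hW1, hWS⟩, hmin⟩ := exists_minimal_of_wellFoundedLT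
      (fun W : Finset V => W ⊆ VS ∧ ρ ∉ W ∧ outDeg tail head R W = 1 ∧ ¬ W ⊆ S) hcrit
    have hne : (W \ S).Nonempty := by rwa [Finset.sdiff_nonempty]
    have h2 := hR₀ (W \ S) (Finset.sdiff_subset.trans hW) (by simp [hρW]) hne
    obtain ⟨t, ht, ht1, ht2, ht3⟩ : ∃ t ∈ R₀, tail t ∈ W ∧ tail t ∉ S ∧ head t ∈ W ∩ S := by
      by_contra! hcon
      have : outDeg tail head R₀ (W \ S) ≤ outDeg tail head R W := by
        refine Finset.card_le_card fun t ht => ?_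
        simp only [Finset.mem_filter, Finset.mem_sdiff, not_and, not_not] at ht ⊢
        have := hcon t ht.1 ht.2.1.1 ht.2.1.2
        rw [Finset.mem_inter] at this
        exact ⟨hRS t ht.1 ht.2.1.2, ht.2.1.1, fun h => this ⟨h, ht.2.2 h⟩⟩
      omega
    rw [Finset.mem_inter] at ht3
    refine ⟨t, ht, hW ht1, ht2, ht3.2, fun W' hW' hρW' hne' => ?_⟩
    by_cases hl : tail t ∈ W' ∧ head t ∉ W'
    · have h1 := hR W' hW' hρW' hne'
      by_contra hlt
      have h3 := outDeg_le_outDeg_erase_add_one (tail := tail) (head := head) R W' t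
      have h4 := outDeg_inter_add_union (tail := tail) (head := head) R W W'
      have h5 := hR (W ∩ W') (Finset.inter_subset_left.trans hW) (by simp [hρW])
        ⟨_, Finset.mem_inter.2 ⟨ht1, hl.1⟩⟩
      have h6 := hR (W ∪ W') (Finset.union_subset hW hW') (by simp [hρW, hρW'])
        ⟨_, Finset.mem_union_left _ ht1⟩
      have h7 := hmin (y := W ∩ W') ⟨Finset.inter_subset_left.trans hW, by simp [hρW], by omega,
        fun h => ht2 (h (Finset.mem_inter.2 ⟨ht1, hl.1⟩))⟩ Finset.inter_subset_left
      exact hl.2 (Finset.mem_inter.1 (h7 ht3.1)).2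
    · rw [outDeg_erase_of_not hl]
      exact hR W' hW' hρW' hne'
  · push Not at hcrit
    have hne : (VS \ S).Nonempty := Finset.sdiff_nonempty.2 hS.2
    obtain ⟨t, ht, ht1, ht2⟩ := exists_mem_of_outDeg_pos
      (two_pos.trans_le (hR₀ (VS \ S) Finset.sdiff_subset (by simp [hρ]) hne))
    rw [Finset.mem_sdiff] at ht1
    refine ⟨t, ht, ht1.1, ht1.2, by simpa [hh t ht] using ht2, fun W hW hρW hne' => ?_⟩
    by_cases hl : tail t ∈ W ∧ head t ∉ W
    · have h1 := hR W hW hρW hne'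
      have h3 := outDeg_le_outDeg_erase_add_one (tail := tail) (head := head) R W t
      have h4 := fun h => hcrit W hW hρW h
      have h5 : ¬ W ⊆ S := fun h => ht1.2 (h hl.1)
      have : outDeg tail head R W ≠ 1 := fun h => h5 (h4 h)
      omega
    · rw [outDeg_erase_of_not hl]
      exact hR W hW hρW hne'

/-- Edmonds' theorem for two disjoint arborescences. -/
theorem exists_two_ranks {R₀ : Finset α} {VS : Finset V} {ρ : V} (hρ : ρ ∈ VS)
    (hh : ∀ t ∈ R₀, head t ∈ VS)
    (hR₀ : ∀ W ⊆ VS, ρ ∉ W → W.Nonempty → 2 ≤ outDeg tail head R₀ W) :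
    ∃ T ⊆ R₀, Set.InjOn tail T ∧ ∃ ra rb : V → ℕ, (∀ t ∈ T, ra (head t) < ra (tail t)) ∧
      (∀ v ∈ VS, v ≠ ρ → ∃ t ∈ T, tail t = v) ∧
      ∀ v ∈ VS, v ≠ ρ → ∃ t ∈ R₀ \ T, tail t = v ∧ rb (head t) < rb v := by
  have key : ∀ n < VS.card, ∃ S ⊆ VS, ρ ∈ S ∧ S.card = n + 1 ∧ ∃ T ⊆ R₀, Set.InjOn tail T ∧
      (∀ t ∈ T, tail t ∈ S ∧ head t ∈ S) ∧
      (∀ W ⊆ VS, ρ ∉ W → W.Nonempty → 1 ≤ outDeg tail head (R₀ \ T) W) ∧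
      (∀ v ∈ S, v ≠ ρ → ∃ t ∈ T, tail t = v) ∧
      ∃ r : V → ℕ, ∀ t ∈ T, r (head t) < r (tail t) := by
    intro n
    induction n with
    | zero =>
      intro _
      refine ⟨{ρ}, by simpa using hρ, by simp, by simp, ∅, by simp, by simp, by simp,
        fun W h1 h2 h3 => ?_, fun v hv hv' => absurd (Finset.mem_singleton.1 hv) hv',
        fun _ => 0, by simp⟩
      have := hR₀ W h1 h2 h3
      rw [Finset.sdiff_empty]
      omega
    | succ n ih =>
      intro hn
      obtain ⟨S, hS, hρS, hcard, T, hT, hinj, hTS, hout, hcov, r, hr⟩ := ih (by omega)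
      obtain ⟨t, ht, ht0, ht1, ht2, ht3⟩ := exists_arc_of_two_le_outDeg (R := R₀ \ T)
        (Finset.ssubset_iff_subset_ne.2 ⟨hS, by rintro rfl; omega⟩) hρS hh hR₀
        (fun t ht htS => Finset.mem_sdiff.2 ⟨ht, fun h => htS (hTS t h).1⟩) hout
      have hnt : head t ≠ tail t := fun h => ht1 (h ▸ ht2)
      refine ⟨insert (tail t) S, Finset.insert_subset ht0 hS, by simp [hρS],
        by rw [Finset.card_insert_of_notMem ht1, hcard], insert t T,
        Finset.insert_subset ht hT, ?_, ?_, ?_, ?_,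
        Function.update r (tail t) (r (head t) + 1), ?_⟩
      · rw [Finset.coe_insert, Set.injOn_insert]
        · refine ⟨hinj, ?_⟩
          rintro ⟨u, hu, hut⟩
          exact ht1 (hut ▸ (hTS u hu).1)
        · exact fun h => ht1 (hTS t h).1
      · intro u hu
        rcases Finset.mem_insert.1 hu with rfl | hu
        · simp [ht2]
        · simp [hTS u hu]
      · rwa [Finset.sdiff_insert]
      · intro v hv hvρ
        rcases Finset.mem_insert.1 hv with rfl | hv
        · exact ⟨t, by simp, rfl⟩
        · obtain ⟨u, hu, rfl⟩ := hcov v hv hvρ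
          exact ⟨u, by simp [hu], rfl⟩
      · intro u hu
        rcases Finset.mem_insert.1 hu with rfl | hu
        · simp [hnt]
        · have h1 : head u ≠ tail t := fun h => ht1 (h ▸ (hTS u hu).2)
          have h2 : tail u ≠ tail t := fun h => ht1 (h ▸ (hTS u hu).1)
          simpa [h1, h2] using hr u hu
  obtain ⟨S, hS, -, hcard, T, hT, hinj, -, hout, hcov, r, hr⟩ := key (VS.card - 1) (by
    have := Finset.card_pos.2 ⟨ρ, hρ⟩
    omega)
  have : S = VS := Finset.eq_of_subset_of_card_le hS (by omega)
  subst this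
  obtain ⟨rb, hrb⟩ := exists_rank_of_outDeg_pos hρ
    (fun t ht => hh t (Finset.mem_sdiff.1 ht).1) hout
  exact ⟨T, hT, hinj, r, rb, hr, hcov, hrb⟩

end Arborescence

namespace LOG

variable {V E : Type} [DecidableEq V]

/-- The edges in `ES` with both ends in `W`. -/
def inner (G : LOG V E) (ES : Finset E) (W : Finset V) : Finset E :=
  ES.filter fun e => G.init e ∈ W ∧ G.term e ∈ W

theorem mem_inner {G : LOG V E} {ES : Finset E} {W : Finset V} {e : E} :
    e ∈ G.inner ES W ↔ e ∈ ES ∧ G.init e ∈ W ∧ G.term e ∈ W := Finset.mem_filter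

/-- A combinatorial form of injective labeled oriented trees. -/
structure IsInjectiveTree (G : LOG V E) (VS : Finset V) (ES : Finset E) : Prop where
  init_mem : ∀ e ∈ ES, G.init e ∈ VS
  label_mem : ∀ e ∈ ES, G.label e ∈ VS
  term_mem : ∀ e ∈ ES, G.term e ∈ VS
  inj : Set.InjOn G.label ES
  card_eq : ES.card + 1 = VS.card
  sparse : ∀ W ⊆ VS, W.Nonempty → (G.inner ES W).card + 1 ≤ W.card

/-- A set of vertices spanning a subtree whose labels belong to it. -/
structure IsClosed (G : LOG V E) (VS : Finset V) (ES : Finset E) (C : Finset V) : Prop where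
  subset : C ⊆ VS
  card_eq : (G.inner ES C).card + 1 = C.card
  label_mem : ∀ e ∈ G.inner ES C, G.label e ∈ C

theorem IsInjectiveTree.restrict {G : LOG V E} {VS : Finset V} {ES : Finset E}
    (h : G.IsInjectiveTree VS ES) {C : Finset V} (hC : G.IsClosed VS ES C) :
    G.IsInjectiveTree C (G.inner ES C) where
  init_mem e he := (mem_inner.1 he).2.1
  label_mem := hC.label_mem
  term_mem e he := (mem_inner.1 he).2.2
  inj := h.inj.mono fun e he => (mem_inner.1 he).1
  card_eq := hC.card_eq
  sparse W hW hne := by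
    refine le_trans (Nat.succ_le_succ (Finset.card_le_card fun e he => ?_))
      (h.sparse W (hW.trans hC.subset) hne)
    rw [mem_inner, mem_inner] at he
    exact mem_inner.2 ⟨he.1.1, he.2⟩

/-- The map collapsing `C` to the vertex `c`. -/
def collapse (C : Finset V) (c v : V) : V := if v ∈ C then c else v

theorem collapse_of_mem {C : Finset V} {v : V} (c : V) (h : v ∈ C) : collapse C c v = c := if_pos h

theorem collapse_of_notMem {C : Finset V} {v : V} (c : V) (h : v ∉ C) : collapse C c v = v :=
  if_neg h

theorem collapse_mem {C W : Finset V} {c v : V} (hv : v ∈ W) :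
    collapse C c v ∈ insert c (W \ C) := by
  unfold collapse
  split_ifs with h <;> simp [h, hv]

/-- The graph obtained by collapsing `C` to the vertex `c`. -/
def contract (G : LOG V E) (C : Finset V) (c : V) : LOG V E where
  init e := collapse C c (G.init e)
  label e := collapse C c (G.label e)
  term e := collapse C c (G.term e)

variable [DecidableEq E]

theorem card_insert_sdiff {C VS : Finset V} (hC : C ⊆ VS) {c : V} (hc : c ∈ C) :
    (insert c (VS \ C)).card + C.card = VS.card + 1 := by
  rw [Finset.card_insert_of_notMem (by simp [hc]), Finset.card_sdiff_of_subset hC]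
  have := Finset.card_le_card hC
  omega

theorem IsInjectiveTree.contract {G : LOG V E} {VS : Finset V} {ES : Finset E}
    (h : G.IsInjectiveTree VS ES) {C : Finset V} (hC : G.IsClosed VS ES C) {c : V} (hc : c ∈ C) :
    (G.contract C c).IsInjectiveTree (insert c (VS \ C)) (ES \ G.inner ES C) where
  init_mem e he := collapse_mem (h.init_mem e (Finset.mem_sdiff.1 he).1)
  label_mem e he := collapse_mem (h.label_mem e (Finset.mem_sdiff.1 he).1)
  term_mem e he := collapse_mem (h.term_mem e (Finset.mem_sdiff.1 he).1)
  inj e he e' he' hee := by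
    simp only [LOG.contract] at hee
    rw [Finset.mem_coe, Finset.mem_sdiff] at he he'
    by_cases h1 : G.label e ∈ C <;> by_cases h2 : G.label e' ∈ C
    · by_contra hne
      have h3 : (insert e (insert e' (G.inner ES C))).card = (G.inner ES C).card + 2 := by
        rw [Finset.card_insert_of_notMem (by simp [hne, he.2]),
          Finset.card_insert_of_notMem he'.2]
      have h4 : (insert e (insert e' (G.inner ES C))).card ≤ C.card := by
        refine Finset.card_le_card_of_injOn G.label (fun u hu => ?_) (h.inj.mono fun u hu => ?_)
        · simp only [Finset.coe_insert, Set.mem_insert_iff, Finset.mem_coe] at hu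
          rcases hu with rfl | rfl | hu
          exacts [h1, h2, hC.label_mem _ hu]
        · simp only [Finset.coe_insert, Set.mem_insert_iff, Finset.mem_coe] at hu
          rcases hu with rfl | rfl | hu
          exacts [he.1, he'.1, (mem_inner.1 hu).1]
      have := hC.card_eq
      omega
    · rw [collapse_of_mem _ h1, collapse_of_notMem _ h2] at hee
      exact absurd (hee ▸ hc) h2
    · rw [collapse_of_mem _ h2, collapse_of_notMem _ h1] at hee
      exact absurd (hee ▸ hc) h1
    · rw [collapse_of_notMem _ h1, collapse_of_notMem _ h2] at hee
      exact h.inj he.1 he'.1 hee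
  card_eq := by
    have h1 := card_insert_sdiff hC.subset hc
    have h2 := hC.card_eq
    have h3 := h.card_eq
    have h4 : G.inner ES C ⊆ ES := Finset.filter_subset _ _
    have h5 := Finset.card_le_card h4
    rw [Finset.card_sdiff_of_subset h4]
    omega
  sparse W hW hne := by
    by_cases hcW : c ∈ W
    · have hsub : W.erase c ⊆ VS \ C := by
        rw [← Finset.erase_insert (s := VS \ C) (a := c) (by simp [hc])]
        exact Finset.erase_subset_erase _ hW
      have hdisj : Disjoint (W.erase c) C :=
        Finset.disjoint_of_subset_left hsub Finset.sdiff_disjoint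
      have h1 := h.sparse (W.erase c ∪ C)
        (Finset.union_subset (hsub.trans Finset.sdiff_subset) hC.subset)
        ⟨c, Finset.mem_union_right _ hc⟩
      rw [Finset.card_union_of_disjoint hdisj] at h1
      have h2 := Finset.card_erase_add_one hcW
      have hmem : ∀ v, collapse C c v ∈ W → v ∈ W.erase c ∪ C := by
        intro v hv
        by_cases hvC : v ∈ C
        · exact Finset.mem_union_right _ hvC
        · rw [collapse_of_notMem _ hvC] at hv
          refine Finset.mem_union_left _ (Finset.mem_erase.2 ⟨?_, hv⟩)
          rintro rfl
          exact hvC hc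
      have h3 : (G.contract C c).inner (ES \ G.inner ES C) W ∪ G.inner ES C ⊆
          G.inner ES (W.erase c ∪ C) := by
        refine Finset.union_subset (fun e he => ?_) fun e he => ?_
        · rw [mem_inner, Finset.mem_sdiff] at he
          exact mem_inner.2 ⟨he.1.1, hmem _ he.2.1, hmem _ he.2.2⟩
        · rw [mem_inner] at he
          exact mem_inner.2 ⟨he.1, Finset.mem_union_right _ he.2.1,
            Finset.mem_union_right _ he.2.2⟩
      have h4 := Finset.card_le_card h3
      rw [Finset.card_union_of_disjoint] at h4
      · have := hC.card_eq
        omega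
      · refine Finset.disjoint_left.2 fun e he he' => ?_
        rw [mem_inner, Finset.mem_sdiff] at he
        exact he.1.2 he'
    · have hWS : ∀ v ∈ W, v ∈ VS ∧ v ∉ C := by
        intro v hv
        rcases Finset.mem_insert.1 (hW hv) with rfl | h
        · exact absurd hv hcW
        · exact Finset.mem_sdiff.1 h
      have hmem : ∀ v, collapse C c v ∈ W → v ∈ W := by
        intro v hv
        by_cases hvC : v ∈ C
        · rw [collapse_of_mem _ hvC] at hv
          exact absurd hv hcW
        · rwa [collapse_of_notMem _ hvC] at hv
      refine le_trans (Nat.succ_le_succ (Finset.card_le_card fun e he => ?_))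
        (h.sparse W (fun v hv => (hWS v hv).1) hne)
      rw [mem_inner, Finset.mem_sdiff] at he
      exact mem_inner.2 ⟨he.1.1, hmem _ he.2.1, hmem _ he.2.2⟩

/-- Either Edmonds' condition holds, or there is a nontrivial closed set. -/
theorem IsInjectiveTree.ranks_or_closed {G : LOG V E} {VS : Finset V} {ES : Finset E}
    (h : G.IsInjectiveTree VS ES) :
    (∃ (s : E → Prop) (ra rb : V → ℕ),
      (∀ e ∈ ES, s e → ra (G.init e) < ra (G.label e) ∧ rb (G.term e) < rb (G.label e)) ∧
      (∀ e ∈ ES, ¬ s e → ra (G.term e) < ra (G.label e) ∧ rb (G.init e) < rb (G.label e))) ∨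
    ∃ C, G.IsClosed VS ES C ∧ 2 ≤ C.card ∧ (C = VS → ∃ e, ES = {e} ∧ G.init e ≠ G.term e ∧
      (G.label e = G.init e ∨ G.label e = G.term e)) := by
  have himg : (ES.image G.label).card = ES.card := Finset.card_image_of_injOn h.inj
  have hsub : ES.image G.label ⊆ VS := by
    intro v hv
    obtain ⟨e, he, rfl⟩ := Finset.mem_image.1 hv
    exact h.label_mem e he
  obtain ⟨ρ, hρ⟩ : ∃ ρ, VS \ ES.image G.label = {ρ} := by
    rw [← Finset.card_eq_one, Finset.card_sdiff_of_subset hsub, himg]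
    have := h.card_eq
    omega
  have hρ' : ∀ v, v ∈ VS ∧ v ∉ ES.image G.label ↔ v = ρ := by
    intro v
    rw [← Finset.mem_sdiff, hρ, Finset.mem_singleton]
  have hρVS := (hρ' ρ).2 rfl
  let tail : E × Bool → V := fun t => G.label t.1
  let head : E × Bool → V := fun t => if t.2 then G.init t.1 else G.term t.1
  let R₀ : Finset (E × Bool) := ES ×ˢ Finset.univ
  have hR₀ : ∀ t, t ∈ R₀ ↔ t.1 ∈ ES := by simp [R₀]
  by_cases hW : ∀ W ⊆ VS, ρ ∉ W → W.Nonempty → 2 ≤ outDeg tail head R₀ W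
  · left
    obtain ⟨T, hT, hinj, ra, rb, hra, hcov, hrb⟩ := exists_two_ranks hρVS.1 (R₀ := R₀)
      (fun t ht => by
        have := (hR₀ t).1 ht
        simp only [head]
        split_ifs
        exacts [h.init_mem _ this, h.term_mem _ this]) hW
    have hne : ∀ e ∈ ES, G.label e ≠ ρ := by
      rintro e he rfl
      exact hρVS.2 (Finset.mem_image_of_mem _ he)
    refine ⟨fun e => (e, true) ∈ T, ra, rb, fun e he hs => ⟨hra _ hs, ?_⟩, fun e he hs => ?_⟩
    · obtain ⟨⟨e', b⟩, ht, h1, h2⟩ := hrb _ (h.label_mem e he) (hne e he)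
      rw [Finset.mem_sdiff, hR₀] at ht
      obtain rfl := h.inj ht.1 he h1
      cases b
      · exact h2
      · exact absurd hs ht.2
    · obtain ⟨⟨e', b⟩, ht, h1⟩ := hcov _ (h.label_mem e he) (hne e he)
      obtain rfl := h.inj ((hR₀ _).1 (hT ht)) he h1
      cases b
      · refine ⟨hra _ ht, ?_⟩
        obtain ⟨⟨e, b⟩, ht', h1, h2⟩ := hrb _ (h.label_mem e' he) (hne e' he)
        rw [Finset.mem_sdiff, hR₀] at ht'
        obtain rfl := h.inj ht'.1 he h1
        cases b
        · exact absurd ht ht'.2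
        · exact h2
      · exact absurd ht hs
  · right
    push Not at hW
    obtain ⟨W, hWS, hρW, hne, hout⟩ := hW
    let F := ES.filter fun e => G.label e ∈ W
    have hF : ∀ e, e ∈ F ↔ e ∈ ES ∧ G.label e ∈ W := by simp [F]
    have hFcard : F.card = W.card := by
      rw [← Finset.card_image_of_injOn (h.inj.mono (fun e he => ((hF e).1 he).1))]
      congr 1
      ext v
      simp only [Finset.mem_image, hF]
      constructor
      · rintro ⟨e, ⟨-, he⟩, rfl⟩
        exact he
      · intro hv
        have : v ∈ ES.image G.label := by
          by_contra hcon
          exact hρW ((hρ' v).1 ⟨hWS hv, hcon⟩ ▸ hv)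
        obtain ⟨e, he, rfl⟩ := Finset.mem_image.1 this
        exact ⟨e, ⟨he, hv⟩, rfl⟩
    have hsp := h.sparse W hWS hne
    obtain ⟨e, heF, heW⟩ : ∃ e ∈ F, e ∉ G.inner ES W := by
      by_contra! hcon
      have := Finset.card_le_card hcon
      omega
    obtain ⟨heS, hel⟩ := (hF e).1 heF
    have hone : ∀ t t', t.1 ∈ ES → t'.1 ∈ ES → tail t ∈ W → tail t' ∈ W → head t ∉ W →
        head t' ∉ W → t = t' := by
      intro t t' h1 h1' h2 h2' h3 h3'
      refine Finset.card_le_one.1 (Nat.lt_succ_iff.1 hout) t ?_ t' ?_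
      · exact Finset.mem_filter.2 ⟨(hR₀ t).2 h1, h2, h3⟩
      · exact Finset.mem_filter.2 ⟨(hR₀ t').2 h1', h2', h3'⟩
    have hbad : ∀ e ∈ F, e ∉ G.inner ES W → ∃ b, head (e, b) ∉ W := by
      intro e he he'
      rw [mem_inner] at he'
      by_cases hi : G.init e ∈ W
      · exact ⟨false, fun ht => he' ⟨((hF e).1 he).1, hi, ht⟩⟩
      · exact ⟨true, hi⟩
    obtain ⟨b, hb⟩ := hbad e heF heW
    have hin : F.erase e ⊆ G.inner ES W := by
      intro e' he'
      rw [Finset.mem_erase] at he'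
      by_contra hcon
      obtain ⟨b', hb'⟩ := hbad e' he'.2 hcon
      have h2 := (hF e').1 he'.2
      exact he'.1 (congrArg Prod.fst (hone (e', b') (e, b) h2.1 heS h2.2 hel hb' hb))
    have hFe := Finset.card_erase_add_one heF
    have hin' : F.erase e = G.inner ES W :=
      Finset.eq_of_subset_of_card_le hin (by omega)
    rcases Nat.lt_or_ge 1 W.card with h2 | h2
    · refine ⟨W, ⟨hWS, by rw [← hin']; omega, fun e' he' => ?_⟩, h2, ?_⟩
      · rw [← hin'] at he'
        exact ((hF e').1 (Finset.mem_of_mem_erase he')).2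
      · rintro rfl
        exact absurd hρVS.1 hρW
    · obtain ⟨w, rfl⟩ := Finset.card_eq_one.1 (le_antisymm h2 (Finset.card_pos.2 hne))
      have hw : G.label e = w := Finset.mem_singleton.1 hel
      have hother : head (e, !b) = w := by
        by_contra hcon
        have := hone (e, !b) (e, b) heS heS hel hel (by simpa using hcon) hb
        simp at this
      have hb' : head (e, b) ≠ w := by simpa using hb
      have hendS : head (e, b) ∈ VS := by
        cases b
        exacts [h.term_mem e heS, h.init_mem e heS]
      have hCsub : ({head (e, b), w} : Finset V) ⊆ VS := by
        intro v hv
        rcases Finset.mem_insert.1 hv with rfl | hv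
        exacts [hendS, hWS hv]
      have hCcard : ({head (e, b), w} : Finset V).card = 2 := Finset.card_pair hb'
      have hmem : e ∈ G.inner ES {head (e, b), w} := by
        rw [mem_inner]
        refine ⟨heS, ?_⟩
        cases b <;> simp_all [head]
      have hsp' := h.sparse _ hCsub (by simp)
      have hinn : G.inner ES {head (e, b), w} = {e} := by
        symm
        refine Finset.eq_of_subset_of_card_le (by simpa using hmem) ?_
        rw [Finset.card_singleton]
        omega
      refine ⟨_, ⟨hCsub, by rw [hinn, hCcard]; rfl, ?_⟩, hCcard.ge, ?_⟩
      · rw [hinn]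
        intro e' he'
        rw [Finset.mem_singleton.1 he', hw]
        simp
      · intro hVS
        have hES : ES = {e} := by
          symm
          refine Finset.eq_of_subset_of_card_le (by simpa using heS) ?_
          have := h.card_eq
          rw [← hVS, hCcard] at this
          rw [Finset.card_singleton]
          omega
        refine ⟨e, hES, ?_⟩
        cases b
        · have h1 : G.term e ≠ w := hb'
          have h3 : G.init e = w := hother
          rw [h3, hw]
          exact ⟨h1.symm, .inl rfl⟩
        · have h1 : G.init e ≠ w := hb'
          have h3 : G.term e = w := hother
          rw [h3, hw]
          exact ⟨h1, .inr rfl⟩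

end LOG

namespace LOG

variable {V E A : Type} [Group A]

theorem place_self {B : Type} (o : V) (g : V → B) (x : B) : place o g o x = x := if_pos rfl

theorem place_of_ne {B : Type} {o v : V} (h : v ≠ o) (g : V → B) (x : B) : place o g v x = g v :=
  if_neg h

theorem solvable_of_const (G : LOG V E) (ES : Finset E) (o : V) (deg : A →* Multiplicative ℤ)
    (x y z : E → A) (u : A) (hu : deg u = Multiplicative.ofAdd 1)
    (h : ∀ e ∈ ES, place o (fun _ => u) (G.init e) (x e) * place o (fun _ => u) (G.label e) (z e) =
      place o (fun _ => u) (G.label e) (z e) * place o (fun _ => u) (G.term e) (y e)) :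
    G.Solvable ES o deg x y z :=
  ⟨A, _, MonoidHom.id A, deg, fun _ => u, fun _ _ h => h, fun _ => rfl, fun _ => hu, h⟩

theorem solvable_singleton (G : LOG V E) (e : E) (o : V) (deg : A →* Multiplicative ℤ)
    (x y z : E → A) (hx : ∀ e, deg (x e) = Multiplicative.ofAdd 1)
    (hy : ∀ e, deg (y e) = Multiplicative.ofAdd 1)
    (hne : G.init e ≠ G.term e) (hl : G.label e = G.init e ∨ G.label e = G.term e) :
    G.Solvable {e} o deg x y z := by
  by_cases ho : G.label e = o
  · subst ho
    rcases hl with hl | hl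
    · refine solvable_of_const G _ _ deg x y z ((z e)⁻¹ * x e * z e) (by simp [hx]) ?_
      simp only [Finset.mem_singleton, forall_eq]
      rw [← hl, place_self, place_self, place_of_ne (hl ▸ hne.symm)]
      group
    · refine solvable_of_const G _ _ deg x y z (z e * y e * (z e)⁻¹) (by simp [hy]) ?_
      simp only [Finset.mem_singleton, forall_eq]
      rw [← hl, place_self, place_self, place_of_ne (hl ▸ hne)]
      group
  · rcases hl with hl | hl
    · refine solvable_of_const G _ _ deg x y z (y e) (hy e) ?_
      simp only [Finset.mem_singleton, forall_eq]
      rw [← hl, place_of_ne ho, place_of_ne ho]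
      congr 1
      unfold place
      split_ifs <;> rfl
    · refine solvable_of_const G _ _ deg x y z (x e) (hx e) ?_
      simp only [Finset.mem_singleton, forall_eq]
      rw [← hl, place_of_ne ho, place_of_ne ho]
      congr 1
      unfold place
      split_ifs <;> rfl

variable [DecidableEq V] [DecidableEq E]

theorem solvable_of_contract_of_mem (G : LOG V E) {ES : Finset E} {C : Finset V} {o : V}
    (ho : o ∈ C) (hlab : ∀ e ∈ G.inner ES C, G.label e ∈ C) (deg : A →* Multiplicative ℤ)
    (x y z : E → A) (hx : ∀ e, deg (x e) = Multiplicative.ofAdd 1)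
    (hy : ∀ e, deg (y e) = Multiplicative.ofAdd 1) (hz : ∀ e, deg (z e) = Multiplicative.ofAdd 1)
    (h1 : G.Solvable (G.inner ES C) o deg x y z)
    (h2 : ∀ (B : Type) [Group B] (d : B →* Multiplicative ℤ) (x y z : E → B),
      (∀ e, d (x e) = Multiplicative.ofAdd 1) → (∀ e, d (y e) = Multiplicative.ofAdd 1) →
      (∀ e, d (z e) = Multiplicative.ofAdd 1) →
      (G.contract C o).Solvable (ES \ G.inner ES C) o d x y z) :
    G.Solvable ES o deg x y z := by
  obtain ⟨B, _, θ, d, g, hθ, hd, hg, hrel⟩ := h1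
  have hdeg : ∀ v u, deg u = Multiplicative.ofAdd 1 →
      d (place o g v (θ u)) = Multiplicative.ofAdd 1 := by
    intro v u hu
    unfold place
    split_ifs
    exacts [(hd u).trans hu, hg v]
  obtain ⟨B', _, θ', d', g', hθ', hd', hg', hrel'⟩ := h2 B d
    (fun e => place o g (G.init e) (θ (x e))) (fun e => place o g (G.term e) (θ (y e)))
    (fun e => place o g (G.label e) (θ (z e))) (fun e => hdeg _ _ (hx e))
    (fun e => hdeg _ _ (hy e)) (fun e => hdeg _ _ (hz e))
  let k : V → B' := fun v => if v ∈ C then θ' (g v) else g' v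
  have hplace : ∀ v u, place o k v ((θ'.comp θ) u) =
      place o g' (collapse C o v) (θ' (place o g v (θ u))) := by
    intro v u
    by_cases hv : v ∈ C
    · rw [collapse_of_mem _ hv, place_self]
      by_cases hvo : v = o
      · subst hvo
        rw [place_self, place_self]
        rfl
      · rw [place_of_ne hvo, place_of_ne hvo]
        simp [k, hv]
    · have hvo : v ≠ o := fun h => hv (h ▸ ho)
      rw [collapse_of_notMem _ hv, place_of_ne hvo, place_of_ne hvo]
      simp [k, hv]
  refine ⟨B', _, θ'.comp θ, d', k, hθ'.comp hθ, fun a => (hd' _).trans (hd a), fun v => ?_,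
    fun e he => ?_⟩
  · simp only [k]
    split_ifs
    exacts [(hd' _).trans (hg v), hg' v]
  · rw [hplace, hplace, hplace]
    by_cases hin : e ∈ G.inner ES C
    · have := mem_inner.1 hin
      rw [collapse_of_mem _ this.2.1, collapse_of_mem _ this.2.2, collapse_of_mem _ (hlab e hin),
        place_self, place_self, place_self, ← map_mul, hrel e hin, map_mul]
    · exact hrel' e (Finset.mem_sdiff.2 ⟨he, hin⟩)

theorem solvable_of_contract_of_notMem (G : LOG V E) {ES : Finset E} {C : Finset V} {o c : V}
    (ho : o ∉ C) (hc : c ∈ C) (hlab : ∀ e ∈ G.inner ES C, G.label e ∈ C)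
    (deg : A →* Multiplicative ℤ) (x y z : E → A)
    (h : (G.contract C c).Solvable (ES \ G.inner ES C) o deg x y z) :
    G.Solvable ES o deg x y z := by
  obtain ⟨B, _, θ, d, g, hθ, hd, hg, hrel⟩ := h
  have hplace : ∀ v u, place o (fun v => g (collapse C c v)) v u =
      place o g (collapse C c v) u := by
    intro v u
    by_cases hv : v ∈ C
    · rw [collapse_of_mem _ hv, place_of_ne (ne_of_mem_of_not_mem hv ho),
        place_of_ne (ne_of_mem_of_not_mem hc ho), collapse_of_mem _ hv]
    · simp only [place, collapse_of_notMem _ hv]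
  refine ⟨B, _, θ, d, fun v => g (collapse C c v), hθ, hd, fun v => hg _, fun e he => ?_⟩
  rw [hplace, hplace, hplace]
  by_cases hin : e ∈ G.inner ES C
  · have := mem_inner.1 hin
    have hco : c ≠ o := fun h => ho (h ▸ hc)
    rw [collapse_of_mem _ this.2.1, collapse_of_mem _ this.2.2, collapse_of_mem _ (hlab e hin),
      place_of_ne hco, place_of_ne hco, place_of_ne hco]
  · exact hrel e (Finset.mem_sdiff.2 ⟨he, hin⟩)

theorem IsInjectiveTree.solvable {G : LOG V E} {VS : Finset V} {ES : Finset E}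
    (h : G.IsInjectiveTree VS ES) (o : V) (deg : A →* Multiplicative ℤ) (x y z : E → A)
    (hx : ∀ e, deg (x e) = Multiplicative.ofAdd 1) (hy : ∀ e, deg (y e) = Multiplicative.ofAdd 1)
    (hz : ∀ e, deg (z e) = Multiplicative.ofAdd 1) : G.Solvable ES o deg x y z := by
  induction hn : VS.card using Nat.strong_induction_on generalizing G VS ES A with
  | _ n ih =>
    subst hn
    rcases h.ranks_or_closed with ⟨s, ra, rb, hs, hs'⟩ | ⟨C, hC, h2, hVS⟩
    · exact solvable_of_ranks G ES h.inj o deg x y z hx hy hz s ra rb hs hs'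
    by_cases hCV : C = VS
    · obtain ⟨e, rfl, hne, hl⟩ := hVS hCV
      exact solvable_singleton G e o deg x y z hx hy hne hl
    have hlt : C.card < VS.card :=
      Finset.card_lt_card (Finset.ssubset_iff_subset_ne.2 ⟨hC.subset, hCV⟩)
    have hlt' : ∀ c ∈ C, (insert c (VS \ C)).card < VS.card := fun c hc => by
      have := card_insert_sdiff hC.subset hc
      omega
    by_cases ho : o ∈ C
    · exact solvable_of_contract_of_mem G ho hC.label_mem deg x y z hx hy hz
        (ih _ hlt (h.restrict hC) deg x y z hx hy hz rfl)
        fun B _ d x y z hx hy hz => ih _ (hlt' o ho) (h.contract hC ho) d x y z hx hy hz rfl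
    · obtain ⟨c, hc⟩ : C.Nonempty := Finset.card_pos.1 (by omega)
      exact solvable_of_contract_of_notMem G ho hc hC.label_mem deg x y z
        (ih _ (hlt' c hc) (h.contract hC hc) deg x y z hx hy hz rfl)

end LOG

theorem SimpleGraph.IsAcyclic.card_edgeSet_add_one_le {V : Type} [Finite V] [Nonempty V]
    {H : SimpleGraph V} (hH : H.IsAcyclic) : Nat.card H.edgeSet + 1 ≤ Nat.card V := by
  obtain ⟨T, hle, -, hT⟩ :=
    (SimpleGraph.connected_top (V := V)).exists_isTree_le_of_le_of_isAcyclic le_top hH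
  rw [← (SimpleGraph.isTree_iff_connected_and_card.1 hT).2]
  exact Nat.add_le_add_right
    (Nat.card_mono (Set.toFinite _) (SimpleGraph.edgeSet_mono hle)) 1

namespace LOG

variable {V E : Type}

section Tree

variable [Fintype V] [Fintype E] [DecidableEq V] {G : LOG V E}

theorem IsTreeGraph.isInjectiveTree (htree : G.IsTreeGraph) (hinj : G.InjectiveLabels) :
    G.IsInjectiveTree Finset.univ Finset.univ := by
  obtain ⟨hloop, hends, htree⟩ := htree
  have hadj : ∀ e, G.graph.Adj (G.init e) (G.term e) := fun e =>
    (SimpleGraph.fromRel_adj _ _ _).2 ⟨hloop e, .inl ⟨e, rfl, rfl⟩⟩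
  refine ⟨fun _ _ => Finset.mem_univ _, fun _ _ => Finset.mem_univ _,
    fun _ _ => Finset.mem_univ _, hinj.injOn, ?_, fun W _ hW => ?_⟩
  · have h := (SimpleGraph.isTree_iff_connected_and_card.1 htree).2
    rw [Finset.card_univ, Finset.card_univ, ← Nat.card_eq_fintype_card,
      ← Nat.card_eq_fintype_card (α := V), ← h]
    congr 1
    refine Nat.card_eq_of_bijective (fun e => ⟨s(G.init e, G.term e), hadj e⟩)
      ⟨fun e e' h => hends (congrArg Subtype.val h), ?_⟩
    rintro ⟨⟨a, b⟩, hab⟩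
    obtain ⟨-, ⟨e, rfl, rfl⟩ | ⟨e, rfl, rfl⟩⟩ := 
      (SimpleGraph.fromRel_adj _ _ _).1 ((SimpleGraph.mem_edgeSet _).1 hab)
    · exact ⟨e, rfl⟩
    · exact ⟨e, Subtype.ext Sym2.eq_swap⟩
  · have : Nonempty (W : Set V) := hW.to_subtype
    have h := (htree.isAcyclic.induce (W : Set V)).card_edgeSet_add_one_le
    have hle : (G.inner Finset.univ W).card ≤ Nat.card (G.graph.induce (W : Set V)).edgeSet := by
      rw [← Nat.card_eq_finsetCard]
      refine Nat.card_le_card_of_injective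
        (fun e => ⟨s(⟨G.init e, (mem_inner.1 e.2).2.1⟩, ⟨G.term e, (mem_inner.1 e.2).2.2⟩),
          hadj e⟩) fun e e' h => Subtype.ext (hends ?_)
      exact congrArg (Sym2.map Subtype.val) (congrArg Subtype.val h)
    have hW : Nat.card (W : Set V) = W.card := Nat.card_eq_finsetCard W
    omega

theorem IsSubLOT.inner_eq (htree : G.IsTreeGraph) (hinj : G.InjectiveLabels) {C : Finset V}
    {S : Finset E} (hsub : G.IsSubLOT C S) :
    G.inner Finset.univ C = S ∧ S.card + 1 = C.card := by
  have hS : S ⊆ G.inner Finset.univ C := fun e he =>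
    mem_inner.2 ⟨Finset.mem_univ _, hsub.init_mem e he, hsub.term_mem e he⟩
  obtain ⟨e₀, he₀⟩ := hsub.edge_nonempty
  have hle := (htree.isInjectiveTree hinj).sparse C (Finset.subset_univ _)
    ⟨_, hsub.init_mem e₀ he₀⟩
  have hcard : Nat.card (G.subgraph C S).edgeSet ≤ S.card := by
    rw [← Nat.card_eq_finsetCard]
    refine Nat.card_le_card_of_surjective (fun e : S =>
      ⟨s(⟨G.init e, hsub.init_mem e e.2⟩, ⟨G.term e, hsub.term_mem e e.2⟩),
        (SimpleGraph.mem_edgeSet _).2 <| (SimpleGraph.fromRel_adj _ _ _).2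
          ⟨fun hc => htree.1 e (congrArg Subtype.val hc), .inl ⟨e, e.2, rfl, rfl⟩⟩⟩) ?_
    rintro ⟨⟨⟨a, ha⟩, ⟨b, hb⟩⟩, hab⟩
    obtain ⟨-, ⟨e, he, rfl, rfl⟩ | ⟨e, he, rfl, rfl⟩⟩ :=
      (SimpleGraph.fromRel_adj _ _ _).1 ((SimpleGraph.mem_edgeSet _).1 hab)
    · exact ⟨⟨e, he⟩, rfl⟩
    · exact ⟨⟨e, he⟩, Subtype.ext Sym2.eq_swap⟩
  have hconn := hsub.connected.card_vert_le_card_edgeSet_add_one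
  have hC : Nat.card (C : Set V) = C.card := Nat.card_eq_finsetCard C
  have := Finset.card_le_card hS
  exact ⟨(Finset.eq_of_subset_of_card_le hS (by omega)).symm, by omega⟩

end Tree

/-- The degree of an element of the LOT group of a sub-LOT. -/
def subDegree (G : LOG V E) (VS : Set V) (ES : Set E) :
    PresentedGroup (G.subRels VS ES) →* Multiplicative ℤ :=
  PresentedGroup.toGroup (f := fun _ => Multiplicative.ofAdd 1) <| by
    rintro _ ⟨e, -, hi, hl, ht, rfl⟩
    simp

@[simp] theorem subDegree_of (G : LOG V E) (VS : Set V) (ES : Set E) (v : VS) :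
    G.subDegree VS ES (PresentedGroup.of v) = Multiplicative.ofAdd 1 :=
  PresentedGroup.toGroup.of _

theorem subRel_eq (G : LOG V E) {VS : Set V} {ES : Set E} {e : E} (he : e ∈ ES)
    (hi : G.init e ∈ VS) (hl : G.label e ∈ VS) (ht : G.term e ∈ VS) :
    (PresentedGroup.of ⟨G.init e, hi⟩ * PresentedGroup.of ⟨G.label e, hl⟩ :
      PresentedGroup (G.subRels VS ES)) =
    PresentedGroup.of ⟨G.label e, hl⟩ * PresentedGroup.of ⟨G.term e, ht⟩ :=
  mul_inv_eq_one.1 <|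
    PresentedGroup.one_of_mem (rels := G.subRels VS ES) ⟨e, he, hi, hl, ht, rfl⟩

end LOG

/-- **Injective labeled oriented trees have π₁-injective sub-LOTs.**
Let `G` be an injective labeled oriented tree and `H` a sub-LOT of `G`, given by the
vertex set `VS` and the edge set `ES`.  Then the homomorphism `G(H) → G(G)` of LOT
groups induced by the inclusion of generating sets is injective. -/
theorem sublot_group_embeds {V E : Type} [Fintype V] [Fintype E]
    (G : LOG V E) (htree : G.IsTreeGraph) (hinj : G.InjectiveLabels)
    (VS : Set V) (ES : Set E) (hsub : G.IsSubLOT VS ES)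
    (φ : PresentedGroup (G.subRels VS ES) →* PresentedGroup G.rels)
    (hφ : ∀ v : VS, φ (PresentedGroup.of v) = PresentedGroup.of (v : V)) :
    Function.Injective φ := by
  classical
  obtain ⟨C, rfl⟩ := VS.toFinite.exists_finset_coe
  obtain ⟨S, rfl⟩ := ES.toFinite.exists_finset_coe
  have h := htree.isInjectiveTree hinj
  obtain ⟨hin, hcard⟩ := hsub.inner_eq htree hinj
  have hC : G.IsClosed Finset.univ Finset.univ C :=
    ⟨Finset.subset_univ _, by rw [hin, hcard], fun e he => hsub.label_mem e (hin ▸ he)⟩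
  obtain ⟨e₀, he₀⟩ := hsub.edge_nonempty
  obtain ⟨o, ho⟩ : ∃ o, o ∈ C := ⟨_, hsub.init_mem e₀ he₀⟩
  let w : V → PresentedGroup (G.subRels C S) := fun v =>
    if hv : v ∈ C then PresentedGroup.of ⟨v, hv⟩ else PresentedGroup.of ⟨o, ho⟩
  have hw : ∀ v, G.subDegree C S (w v) = Multiplicative.ofAdd 1 := fun v => by
    simp only [w]; split_ifs <;> exact LOG.subDegree_of ..
  obtain ⟨B, _, θ, d, g, hθ, -, -, hg⟩ := (h.contract hC ho).solvable o (G.subDegree C S)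
    (fun e => w (G.init e)) (fun e => w (G.term e)) (fun e => w (G.label e))
    (fun _ => hw _) (fun _ => hw _) (fun _ => hw _)
  let k : V → B := fun v => LOG.place o g (LOG.collapse C o v) (θ (w v))
  have hk : ∀ v (hv : v ∈ C), k v = θ (PresentedGroup.of ⟨v, hv⟩) := fun v hv => by
    simp only [k, LOG.collapse_of_mem o hv, LOG.place_self, w, dif_pos hv]
  have hrel : ∀ e, k (G.init e) * k (G.label e) = k (G.label e) * k (G.term e) := fun e => by
    by_cases he : e ∈ S
    · rw [hk _ (hsub.init_mem e he), hk _ (hsub.label_mem e he), hk _ (hsub.term_mem e he),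
        ← map_mul, ← map_mul, G.subRel_eq he]
    · exact hg e (Finset.mem_sdiff.2 ⟨Finset.mem_univ _, hin ▸ he⟩)
  let K : PresentedGroup G.rels →* B := PresentedGroup.toGroup (f := k) <| by
    rintro _ ⟨e, rfl⟩
    simpa using mul_inv_eq_one.2 (hrel e)
  have hK : K.comp φ = θ := PresentedGroup.ext fun v => by
    rw [MonoidHom.comp_apply, hφ]
    exact (PresentedGroup.toGroup.of _).trans (hk v v.2)
  refine Function.Injective.of_comp (f := K) ?_
  rw [← MonoidHom.coe_comp, hK]
  exact hθ
end

section
/- Let P be a compressed injective labeled oriented tree that does not contain a boundary reducible sub-LOT. Then there exists a reorientation Q of P such that both the positive graph W⁺(Q) and the negative graph W⁻(Q) are trees (connected and acyclic as multigraphs). -/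
/-- A multigraph: each element of the edge index type `E` has two (possibly equal)
endpoints in `V`; loops and multiple edges are allowed. -/
structure Multigraph (V E : Type) where
  fst : E → V
  snd : E → V

namespace Multigraph

variable {V E : Type}

/-- The initial vertex of a dart (an edge together with an orientation). -/
def dstart (G : Multigraph V E) (d : E × Bool) : V := if d.2 then G.fst d.1 else G.snd d.1

/-- The final vertex of a dart. -/
def dfin (G : Multigraph V E) (d : E × Bool) : V := if d.2 then G.snd d.1 else G.fst d.1

/-- An edge cycle: a nonempty list of darts in which consecutive darts match up, cyclically. -/
def IsCycle (G : Multigraph V E) (c : List (E × Bool)) : Prop :=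
  c ≠ [] ∧ List.Chain' (fun d d' => G.dfin d = G.dstart d') c ∧
    ∀ h : c ≠ [], G.dfin (c.getLast h) = G.dstart (c.head h)

/-- A cycle is homology reduced relative to an edge set `E₀` if it does not contain a
pair of darts, with underlying edge outside `E₀`, that are reverses of each other. -/
def HomReducedRel (E₀ : Set E) (c : List (E × Bool)) : Prop :=
  ∀ d ∈ c, d.1 ∉ E₀ → (d.1, !d.2) ∉ c

/-- A cycle is homology reduced if it does not contain a dart together with its reverse. -/
def HomReduced (c : List (E × Bool)) : Prop := HomReducedRel (∅ : Set E) c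

/-- `G` is a forest relative to the subgraph with edge set `E₀`: every cycle which is
homology reduced relative to `E₀` is contained in `E₀`. -/
def IsForestRel (G : Multigraph V E) (E₀ : Set E) : Prop :=
  ∀ c, G.IsCycle c → HomReducedRel E₀ c → ∀ d ∈ c, d.1 ∈ E₀

/-- A forest: there is no nonempty homology reduced cycle. -/
def IsForest (G : Multigraph V E) : Prop := G.IsForestRel ∅

/-- Two vertices are adjacent if they are the two endpoints of some edge. -/
def Adj (G : Multigraph V E) (v w : V) : Prop :=
  ∃ e, (G.fst e = v ∧ G.snd e = w) ∨ (G.fst e = w ∧ G.snd e = v)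

/-- A multigraph is connected if any two vertices are joined by an edge path. -/
def Connected (G : Multigraph V E) : Prop := ∀ v w, Relation.ReflTransGen G.Adj v w

/-- A tree: connected and a forest. -/
def IsTree (G : Multigraph V E) : Prop := G.Connected ∧ G.IsForest

/-- A tree relative to the subgraph with edge set `E₀`. -/
def IsTreeRel (G : Multigraph V E) (E₀ : Set E) : Prop := G.Connected ∧ G.IsForestRel E₀

/-- Reachability inside the subgraph with edge set `E₀`. -/
def ReachIn (G : Multigraph V E) (E₀ : Set E) : V → V → Prop :=
  Relation.ReflTransGen fun a b =>
    ∃ e ∈ E₀, (G.fst e = a ∧ G.snd e = b) ∨ (G.fst e = b ∧ G.snd e = a)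

end Multigraph

namespace LOG

variable {V E : Type}

/-- A LOG is compressed if no edge is labeled with one of its own endpoints. -/
def Compressed (G : LOG V E) : Prop := ∀ e, G.label e ≠ G.init e ∧ G.label e ≠ G.term e

/-- The sub-LOG `(VS, ES)` is boundary reducible: it has a boundary vertex
(a vertex of valency one in the sub-LOG) that does not occur as an edge label
of the sub-LOG. -/
def BoundaryReducibleSub (G : LOG V E) (VS : Set V) (ES : Set E) : Prop :=
  ∃ v ∈ VS, (∃! e, e ∈ ES ∧ (G.init e = v ∨ G.term e = v)) ∧ ∀ e ∈ ES, G.label e ≠ v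

/-- The positive graph `W⁺` of a LOG: for each edge `[x,z,y]` one edge joining `x` and `z`. -/
def Wplus (G : LOG V E) : Multigraph V E := ⟨G.init, G.label⟩

/-- The negative graph `W⁻` of a LOG: for each edge `[x,z,y]` one edge joining `z` and `y`. -/
def Wminus (G : LOG V E) : Multigraph V E := ⟨G.label, G.term⟩

end LOG

/-- `Q` is a reorientation of `G`: `Q` is obtained from `G` by reversing the orientation
of each edge in some subset of the edges, keeping all labels. -/
def IsReorientation {V E : Type} (G Q : LOG V E) : Prop :=
  Q.label = G.label ∧
    ∀ e, (Q.init e = G.init e ∧ Q.term e = G.term e) ∨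
      (Q.init e = G.term e ∧ Q.term e = G.init e)

namespace ArcBranching

variable {V α : Type} (tail head : α → V)

/-- The arcs of `R` that leave the vertex set `S`. -/
def outArcs [DecidableEq V] (R : Finset α) (S : Finset V) : Finset α :=
  R.filter fun a => tail a ∈ S ∧ head a ∉ S

/-- Directed reachability along arcs of `A`. -/
def Reaches (A : Finset α) : V → V → Prop :=
  Relation.ReflTransGen fun x y => ∃ a ∈ A, tail a = x ∧ head a = y

variable {tail head}

theorem Reaches.mono {A B : Finset α} (h : A ⊆ B) {x y : V} (hxy : Reaches tail head A x y) :
    Reaches tail head B x y :=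
  Relation.ReflTransGen.mono (fun _ _ ⟨a, ha, h'⟩ => ⟨a, h ha, h'⟩) _ _ hxy

variable [DecidableEq V]

theorem mem_outArcs {R : Finset α} {S : Finset V} {a : α} :
    a ∈ outArcs tail head R S ↔ a ∈ R ∧ tail a ∈ S ∧ head a ∉ S := by
  simp [outArcs]

theorem card_outArcs_inter_add_union_le (R : Finset α) (S S' : Finset V) :
    (outArcs tail head R (S ∩ S')).card + (outArcs tail head R (S ∪ S')).card ≤
      (outArcs tail head R S).card + (outArcs tail head R S').card := by
  simp only [outArcs, Finset.card_filter, ← Finset.sum_add_distrib]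
  refine Finset.sum_le_sum fun a _ => ?_
  by_cases h1 : tail a ∈ S <;> by_cases h2 : tail a ∈ S' <;> by_cases h3 : head a ∈ S <;>
    by_cases h4 : head a ∈ S' <;> simp [h1, h2, h3, h4]

theorem reaches_of_outArcs_nonempty [Fintype V] {R : Finset α} {r : V}
    (h : ∀ S : Finset V, S.Nonempty → r ∉ S → (outArcs tail head R S).Nonempty) (v : V) :
    Reaches tail head R v r := by
  classical
  by_contra hv
  obtain ⟨a, ha⟩ := h (Finset.univ.filter fun v => ¬ Reaches tail head R v r) ⟨v, by simpa using hv⟩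
    (by simpa using show Reaches tail head R r r from .refl)
  simp only [mem_outArcs, Finset.mem_filter, Finset.mem_univ, true_and, not_not] at ha
  exact ha.2.1 (.head ⟨a, ha.1, rfl, rfl⟩ ha.2.2)

variable [Fintype α] [DecidableEq α]

/-- The extension step of Lovász's proof of Edmonds' branching theorem: there is an arc entering
the branching `T` whose removal from the free arcs keeps every free cut nonempty. -/
theorem exists_extending_arc [Fintype V] {r : V}
    (hcut : ∀ S : Finset V, S.Nonempty → r ∉ S → 2 ≤ (outArcs tail head Finset.univ S).card)
    {T : Finset V} {A : Finset α} (hr : r ∈ T) (hT : T ≠ Finset.univ) (hA : ∀ a ∈ A, tail a ∈ T)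
    (hfree : ∀ S : Finset V, S.Nonempty → r ∉ S → 1 ≤ (outArcs tail head Aᶜ S).card) :
    ∃ a, tail a ∉ T ∧ head a ∈ T ∧ ∀ S : Finset V, S.Nonempty → r ∉ S →
      1 ≤ (outArcs tail head (insert a A)ᶜ S).card := by
  have hremove : ∀ a, tail a ∉ T → (∀ S : Finset V, r ∉ S → tail a ∈ S → head a ∉ S →
      (outArcs tail head Aᶜ S).card ≠ 1) → ∀ S : Finset V, S.Nonempty → r ∉ S →
      1 ≤ (outArcs tail head (insert a A)ᶜ S).card := by
    intro a haT ha S hS hrS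
    have hle := hfree S hS hrS
    have hsub : (outArcs tail head Aᶜ S).erase a ⊆ outArcs tail head (insert a A)ᶜ S := by
      intro b hb
      simp only [mem_outArcs, Finset.mem_erase, Finset.mem_compl, Finset.mem_insert] at hb ⊢
      tauto
    have hcard := Finset.card_le_card hsub
    by_cases hmem : a ∈ outArcs tail head Aᶜ S
    · have hne := ha S hrS (mem_outArcs.1 hmem).2.1 (mem_outArcs.1 hmem).2.2
      rw [Finset.card_erase_of_mem hmem] at hcard
      omega
    · rw [Finset.erase_eq_of_notMem hmem] at hcard
      omega
  by_cases htight : ∃ S : Finset V, r ∉ S ∧ (outArcs tail head Aᶜ S).card = 1 ∧ ¬ S ⊆ T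
  · obtain ⟨S, ⟨hrS, hS1, hST⟩, hmin⟩ := WellFounded.has_min (wellFounded_lt (α := Finset V))
      {S | r ∉ S ∧ (outArcs tail head Aᶜ S).card = 1 ∧ ¬ S ⊆ T} htight
    have hne : (S \ T).Nonempty := by simpa [Finset.nonempty_iff_ne_empty] using hST
    have h2 := hcut (S \ T) hne (by simp [hr])
    obtain ⟨a, ha, haS⟩ : ∃ a ∈ outArcs tail head Finset.univ (S \ T),
        a ∉ outArcs tail head Aᶜ S := by
      by_contra! hsub
      have := Finset.card_le_card hsub
      omega
    simp only [mem_outArcs, Finset.mem_univ, true_and, Finset.mem_sdiff, Finset.mem_compl,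
      not_and, not_not] at ha haS
    obtain ⟨⟨haS', haT⟩, hah⟩ := ha
    have hheadS : head a ∈ S := haS (fun h => haT (hA a h)) haS'
    refine ⟨a, haT, hah hheadS, hremove a haT fun S' hrS' htS' hhS' hS'1 => ?_⟩
    have hsubm := card_outArcs_inter_add_union_le (tail := tail) (head := head) Aᶜ S S'
    have hi := hfree (S ∩ S') ⟨tail a, by simp [haS', htS']⟩ (by simp [hrS])
    have hu := hfree (S ∪ S') ⟨tail a, by simp [haS']⟩ (by simp [hrS, hrS'])
    refine hmin (S ∩ S') ⟨by simp [hrS], by omega, fun h => haT (h (by simp [haS', htS']))⟩ ?_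
    refine Finset.ssubset_iff_subset_ne.2 ⟨Finset.inter_subset_left, fun h => hhS' ?_⟩
    rw [← h] at hheadS
    exact (Finset.mem_inter.1 hheadS).2
  · push Not at htight
    have hne : Tᶜ.Nonempty := by
      rw [Finset.nonempty_iff_ne_empty]
      simpa using hT
    have h2 := hcut Tᶜ hne (by simp [hr])
    obtain ⟨a, ha⟩ := Finset.card_pos.1 (by omega : 0 < (outArcs tail head Finset.univ Tᶜ).card)
    simp only [mem_outArcs, Finset.mem_univ, true_and, Finset.mem_compl, not_not] at ha
    exact ⟨a, ha.1, ha.2, hremove a ha.1 fun S hrS htS _ hS => ha.1 (htight S hrS hS htS)⟩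

/-- Edmonds' branching theorem for two branchings: if at least two arcs leave every nonempty vertex
set avoiding the root `r`, the arcs can be split into two classes along each of which every vertex
reaches `r`. -/
theorem exists_disjoint_reaches [Fintype V] {r : V}
    (hcut : ∀ S : Finset V, S.Nonempty → r ∉ S → 2 ≤ (outArcs tail head Finset.univ S).card) :
    ∃ A : Finset α, (∀ v, Reaches tail head A v r) ∧ ∀ v, Reaches tail head Aᶜ v r := by
  have key : ∀ n, ∀ (T : Finset V) (A : Finset α), Tᶜ.card = n → r ∈ T → (∀ a ∈ A, tail a ∈ T) →
      (∀ v ∈ T, Reaches tail head A v r) →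
      (∀ S : Finset V, S.Nonempty → r ∉ S → 1 ≤ (outArcs tail head Aᶜ S).card) →
      ∃ A : Finset α, (∀ v, Reaches tail head A v r) ∧ ∀ v, Reaches tail head Aᶜ v r := by
    intro n
    induction n with
    | zero =>
      intro T A hn _ _ hreach hfree
      obtain rfl : T = Finset.univ := by simpa using hn
      exact ⟨A, fun v => hreach v (Finset.mem_univ v), reaches_of_outArcs_nonempty
        fun S hS hrS => Finset.card_pos.1 (hfree S hS hrS)⟩
    | succ n ih =>
      intro T A hn hr hA hreach hfree
      obtain ⟨a, hat, hah, hfree'⟩ := exists_extending_arc hcut hr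
        (by rintro rfl; simp at hn) hA hfree
      refine ih (insert (tail a) T) (insert a A) ?_ (by simp [hr]) ?_ ?_ hfree'
      · rw [Finset.card_compl] at hn ⊢
        rw [Finset.card_insert_of_notMem hat]
        omega
      · intro b hb
        rcases Finset.mem_insert.1 hb with rfl | hb
        · simp
        · simp [hA b hb]
      · intro v hv
        rcases Finset.mem_insert.1 hv with rfl | hv
        · exact .head ⟨a, by simp, rfl, rfl⟩ ((hreach _ hah).mono (Finset.subset_insert _ _))
        · exact (hreach v hv).mono (Finset.subset_insert _ _)
  refine key _ {r} ∅ rfl (by simp) (by simp) ?_ ?_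
  · intro v hv
    rw [Finset.mem_singleton.1 hv]
    exact .refl
  · intro S hS hrS
    have := hcut S hS hrS
    simp only [Finset.compl_empty]
    omega

end ArcBranching

namespace SimpleGraph

theorem IsAcyclic.exists_isTree_ge {V : Type*} [Nonempty V] {G : SimpleGraph V}
    (hG : G.IsAcyclic) : ∃ T, G ≤ T ∧ T.IsTree := by
  obtain ⟨T, hGT, -, hT⟩ :=
    (connected_top (V := V)).exists_isTree_le_of_le_of_isAcyclic le_top hG
  exact ⟨T, hGT, hT⟩

theorem IsAcyclic.ncard_edgeSet_lt {V : Type*} [Finite V] [Nonempty V] {G : SimpleGraph V}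
    (hG : G.IsAcyclic) : G.edgeSet.ncard < Nat.card V := by
  obtain ⟨T, hGT, hT⟩ := hG.exists_isTree_ge
  have hcard := (isTree_iff_connected_and_card.1 hT).2
  rw [Nat.card_coe_set_eq] at hcard
  have := Set.ncard_le_ncard (edgeSet_mono hGT) (Set.toFinite _)
  omega

theorem IsAcyclic.connected_of_ncard_edgeSet {V : Type*} [Finite V] [Nonempty V]
    {G : SimpleGraph V} (hG : G.IsAcyclic) (h : G.edgeSet.ncard + 1 = Nat.card V) :
    G.Connected := by
  obtain ⟨T, hGT, hT⟩ := hG.exists_isTree_ge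
  have hcard := (isTree_iff_connected_and_card.1 hT).2
  rw [Nat.card_coe_set_eq] at hcard
  have heq := Set.eq_of_subset_of_ncard_le (edgeSet_mono hGT) (by omega) (Set.toFinite _)
  rw [edgeSet_inj.1 heq]
  exact hT.connected

end SimpleGraph

namespace Multigraph

variable {V E : Type}

theorem IsCycle.exists_next {G : Multigraph V E} {l : List (E × Bool)} (hc : G.IsCycle l)
    {d : E × Bool} (hd : d ∈ l) : ∃ d' ∈ l, G.dfin d = G.dstart d' := by
  obtain ⟨hne, hchain, hclose⟩ := hc
  obtain ⟨i, hi, rfl⟩ := List.mem_iff_getElem.1 hd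
  by_cases h : i + 1 < l.length
  · exact ⟨l[i + 1], List.getElem_mem h, List.isChain_iff_getElem.1 hchain i h⟩
  · refine ⟨l.head hne, List.head_mem hne, ?_⟩
    rw [← hclose hne, List.getLast_eq_getElem]
    congr 2
    omega

theorem IsCycle.exists_prev {G : Multigraph V E} {l : List (E × Bool)} (hc : G.IsCycle l)
    {d : E × Bool} (hd : d ∈ l) : ∃ d' ∈ l, G.dfin d' = G.dstart d := by
  obtain ⟨hne, hchain, hclose⟩ := hc
  obtain ⟨i, hi, rfl⟩ := List.mem_iff_getElem.1 hd
  cases i with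
  | zero =>
    refine ⟨l.getLast hne, List.getLast_mem hne, ?_⟩
    rw [hclose hne, List.head_eq_getElem]
  | succ i =>
    exact ⟨l[i], List.getElem_mem _, List.isChain_iff_getElem.1 hchain i hi⟩

/-- A multigraph is a forest if every edge has an upper endpoint, with respect to some height
function, and distinct edges have distinct upper endpoints. -/
theorem isForest_of_height {ι : Type*} [LinearOrder ι] (G : Multigraph V E) (top : E → V)
    (hinj : Function.Injective top) (h : V → ι)
    (hlt : ∀ e, (G.fst e = top e ∧ h (G.snd e) < h (top e)) ∨
      (G.snd e = top e ∧ h (G.fst e) < h (top e))) : G.IsForest := by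
  classical
  intro c hc hred d hd
  exfalso
  obtain ⟨⟨e, b⟩, hd, hmax⟩ := Finset.exists_max_image c.toFinset (fun d => h (top d.1))
    ⟨d, by simpa using hd⟩
  rw [List.mem_toFinset] at hd
  have hmax' : ∀ d' ∈ c, h (top d'.1) ≤ h (top e) := fun d' hd' => hmax d' (by simpa using hd')
  have hrev : (e, !b) ∉ c := hred (e, b) hd (by simp)
  obtain ⟨⟨e₁, b₁⟩, h₁, hn⟩ := hc.exists_next hd
  obtain ⟨⟨e₂, b₂⟩, h₂, hp⟩ := hc.exists_prev hd
  have hm₁ := hmax' _ h₁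
  have hm₂ := hmax' _ h₂
  have hi₁ := @hinj e e₁
  have hi₂ := @hinj e e₂
  have hl := hlt e
  have hl₁ := hlt e₁
  have hl₂ := hlt e₂
  simp only [dfin, dstart] at hn hp hm₁ hm₂
  cases b <;> cases b₁ <;> cases b₂ <;> simp only [if_true, if_false, Bool.false_eq_true,
    Bool.not_true, Bool.not_false] at * <;> grind

/-- A multigraph is a tree if each edge can be directed away from its own distinct vertex so that
every vertex reaches the root `r`, which is not the start of an edge. -/
theorem isTree_of_reaches (G : Multigraph V E) (top other : E → V)
    (hinj : Function.Injective top) {r : V} (hr : ∀ e, top e ≠ r)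
    (hG : ∀ e, (G.fst e = top e ∧ G.snd e = other e) ∨ (G.snd e = top e ∧ G.fst e = other e))
    (hreach : ∀ v, Relation.ReflTransGen (fun x y => ∃ e, top e = x ∧ other e = y) v r) :
    G.IsTree := by
  have hsymm : Std.Symm G.Adj := ⟨fun v w ⟨e, he⟩ => ⟨e, he.symm⟩⟩
  have hconn : ∀ v, Relation.ReflTransGen G.Adj v r := fun v =>
    Relation.ReflTransGen.mono (fun x y ⟨e, hx, hy⟩ => ⟨e, by have := hG e; grind⟩) _ _ (hreach v)
  refine ⟨fun v w => (hconn v).trans (Std.Symm.symm _ _ (hconn w)), ?_⟩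
  have hwf : WellFounded (fun y x => ∃ e, top e = x ∧ other e = y) := by
    refine ⟨fun v => ?_⟩
    induction hreach v using Relation.ReflTransGen.head_induction_on with
    | refl => exact ⟨_, fun y ⟨e, he, _⟩ => (hr e he).elim⟩
    | head hxy _ ih =>
      refine ⟨_, fun y ⟨e, he, hy⟩ => ?_⟩
      obtain ⟨e', he', rfl⟩ := hxy
      obtain rfl := hinj (he.trans he'.symm)
      exact hy ▸ ih
  have : IsWellFounded V (fun y x => ∃ e, top e = x ∧ other e = y) := ⟨hwf⟩
  refine isForest_of_height G top hinj
    (IsWellFounded.rank fun y x => ∃ e, top e = x ∧ other e = y) fun e => ?_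
  have hlt := IsWellFounded.rank_lt_of_rel (r := fun y x => ∃ e, top e = x ∧ other e = y)
    (a := other e) (b := top e) ⟨e, rfl, rfl⟩
  rcases hG e with ⟨h₁, h₂⟩ | ⟨h₁, h₂⟩
  · exact .inl ⟨h₁, h₂ ▸ hlt⟩
  · exact .inr ⟨h₁, h₂ ▸ hlt⟩

end Multigraph

namespace LOG

variable {V E : Type}

theorem IsTreeGraph.isAcyclic_subgraph {P : LOG V E} (hP : P.IsTreeGraph) (VS : Set V)
    (ES : Set E) : (P.subgraph VS ES).IsAcyclic := by
  refine hP.2.2.isAcyclic.comap (⟨Subtype.val, ?_⟩ : P.subgraph VS ES →g P.graph)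
    Subtype.val_injective
  intro a b hab
  simp only [subgraph, graph, SimpleGraph.fromRel_adj] at hab ⊢
  refine ⟨fun h => hab.1 (Subtype.ext h), ?_⟩
  rcases hab.2 with ⟨e, -, he⟩ | ⟨e, -, he⟩
  · exact .inl ⟨e, he⟩
  · exact .inr ⟨e, he⟩

theorem IsTreeGraph.ncard_le_ncard_edgeSet_subgraph [Finite V] {P : LOG V E}
    (hP : P.IsTreeGraph) {VS : Set V} {ES : Set E} (hi : ∀ e ∈ ES, P.init e ∈ VS)
    (ht : ∀ e ∈ ES, P.term e ∈ VS) : ES.ncard ≤ (P.subgraph VS ES).edgeSet.ncard := by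
  rw [← Nat.card_coe_set_eq, ← Nat.card_coe_set_eq]
  let f : ES → (P.subgraph VS ES).edgeSet := fun e =>
    ⟨s(⟨P.init e, hi e e.2⟩, ⟨P.term e, ht e e.2⟩), by
      simp only [SimpleGraph.mem_edgeSet, subgraph, SimpleGraph.fromRel_adj]
      exact ⟨fun h => hP.1 e (Subtype.ext_iff.1 h), .inl ⟨e, e.2, rfl, rfl⟩⟩⟩
  refine Nat.card_le_card_of_injective f fun e e' h => Subtype.ext (hP.2.1 ?_)
  simpa [f] using congrArg (Sym2.map Subtype.val) (Subtype.ext_iff.1 h)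

theorem IsTreeGraph.card_edges_add_one [Finite V] {P : LOG V E}
    (hP : P.IsTreeGraph) : Nat.card E + 1 = Nat.card V := by
  rw [← (SimpleGraph.isTree_iff_connected_and_card.1 hP.2.2).2, add_left_inj]
  have hedge : P.graph.edgeSet = Set.range fun e => s(P.init e, P.term e) := by
    ext x
    induction x using Sym2.ind with
    | _ a b =>
      simp only [SimpleGraph.mem_edgeSet, graph, SimpleGraph.fromRel_adj, Set.mem_range,
        Sym2.eq_iff]
      have := hP.1
      grind
  rw [hedge]
  exact (Nat.card_range_of_injective hP.2.1).symm

/-- An injectively labeled tree has exactly one vertex that is not a label. -/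
theorem IsTreeGraph.exists_unique_not_label [Finite V] [Finite E] {P : LOG V E}
    (hP : P.IsTreeGraph) (hinj : P.InjectiveLabels) :
    ∃ r, (∀ e, P.label e ≠ r) ∧ ∀ v, v ≠ r → ∃ e, P.label e = v := by
  have h₁ : (Set.range P.label).ncard = Nat.card E := Set.ncard_range_of_injective hinj
  have h₂ := Set.ncard_add_ncard_compl (Set.range P.label)
  have h₃ := hP.card_edges_add_one
  obtain ⟨r, hr⟩ := Set.ncard_eq_one.1 (by omega : (Set.range P.label)ᶜ.ncard = 1)
  refine ⟨r, fun e he => ?_, fun v hv => ?_⟩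
  · have : r ∈ (Set.range P.label)ᶜ := by simp [hr]
    exact this ⟨e, he⟩
  · by_contra h
    have : v ∈ (Set.range P.label)ᶜ := h
    rw [hr] at this
    exact hv this

/-- Each edge gives two arcs, from its label to its two endpoints: this is the start of an arc. -/
def arcTail (P : LOG V E) (a : E × Bool) : V := P.label a.1

/-- Each edge gives two arcs, from its label to its two endpoints: this is the end of an arc. -/
def arcHead (P : LOG V E) (a : E × Bool) : V := if a.2 then P.init a.1 else P.term a.1

open ArcBranching in
theorem IsTreeGraph.two_le_card_outArcs [DecidableEq V] [Fintype V] [Fintype E]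
    {P : LOG V E} (hP : P.IsTreeGraph) (hinj : P.InjectiveLabels)
    (hnb : ∀ (VS : Set V) (ES : Set E), P.IsSubLOT VS ES → ¬ P.BoundaryReducibleSub VS ES)
    {S : Finset V} (hS : S.Nonempty) (hlabel : ∀ v ∈ S, ∃ e, P.label e = v) :
    2 ≤ (outArcs P.arcTail P.arcHead Finset.univ S).card := by
  by_contra! hlt
  let ES : Set E := {e | P.label e ∈ S}
  have hES : ES.ncard = S.card := by
    rw [← Set.ncard_image_of_injective ES hinj, ← Set.ncard_coe_finset]
    congr 1
    ext v
    exact ⟨fun ⟨e, he, h⟩ => h ▸ he, fun hv => by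
      obtain ⟨e, rfl⟩ := hlabel v hv
      exact ⟨e, hv, rfl⟩⟩
  have hout : ∀ a : E × Bool, a.1 ∈ ES → P.arcHead a ∉ S →
      a ∈ outArcs P.arcTail P.arcHead Finset.univ S :=
    fun a h h' => mem_outArcs.2 ⟨Finset.mem_univ a, h, h'⟩
  rcases (by omega : (outArcs P.arcTail P.arcHead Finset.univ S).card = 0 ∨
    (outArcs P.arcTail P.arcHead Finset.univ S).card = 1) with h0 | h1
  · rw [Finset.card_eq_zero] at h0
    have hmem : ∀ a : E × Bool, a.1 ∈ ES → P.arcHead a ∈ S := fun a ha => by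
      by_contra h
      simpa [h0] using hout a ha h
    have hle := hP.ncard_le_ncard_edgeSet_subgraph (VS := (S : Set V)) (ES := ES)
      (fun e he => hmem (e, true) he) (fun e he => hmem (e, false) he)
    have : Nonempty (S : Set V) := hS.to_subtype
    have hlt' := (hP.isAcyclic_subgraph (S : Set V) ES).ncard_edgeSet_lt
    rw [Nat.card_coe_set_eq, Set.ncard_coe_finset] at hlt'
    omega
  · obtain ⟨⟨e₀, b₀⟩, h1⟩ := Finset.card_eq_one.1 h1
    have h₀ : (e₀, b₀) ∈ outArcs P.arcTail P.arcHead Finset.univ S := by simp [h1]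
    obtain ⟨-, he₀, hv₀⟩ := mem_outArcs.1 h₀
    have huniq : ∀ a : E × Bool, a.1 ∈ ES → P.arcHead a ∉ S → a = (e₀, b₀) := fun a ha h => by
      simpa [h1] using hout a ha h
    generalize hv : P.arcHead (e₀, b₀) = v at hv₀
    have hmem : ∀ a : E × Bool, a.1 ∈ ES → P.arcHead a ∈ insert v S := fun a ha => by
      by_cases h : P.arcHead a ∈ S
      · exact Finset.mem_insert_of_mem h
      · rw [huniq a ha h, hv]
        exact Finset.mem_insert_self v S
    have hi : ∀ e ∈ ES, P.init e ∈ (↑(insert v S) : Set V) := fun e he => hmem (e, true) he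
    have ht : ∀ e ∈ ES, P.term e ∈ (↑(insert v S) : Set V) := fun e he => hmem (e, false) he
    have hle := hP.ncard_le_ncard_edgeSet_subgraph hi ht
    have : Nonempty (↑(insert v S) : Set V) := (Finset.insert_nonempty v S).to_subtype
    have hacyc := hP.isAcyclic_subgraph (↑(insert v S) : Set V) ES
    have hlt' := hacyc.ncard_edgeSet_lt
    have hcard : Nat.card (↑(insert v S) : Set V) = S.card + 1 := by
      rw [Nat.card_coe_set_eq, Set.ncard_coe_finset, Finset.card_insert_of_notMem hv₀]
    refine hnb (↑(insert v S)) ES ⟨⟨e₀, he₀⟩, hi, ht, fun e he => ?_,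
      hacyc.connected_of_ncard_edgeSet (by omega)⟩ ⟨v, by simp, ⟨e₀, ⟨he₀, ?_⟩, ?_⟩, ?_⟩
    · exact Finset.mem_insert_of_mem he
    · cases b₀
      · exact .inr hv
      · exact .inl hv
    · rintro e ⟨he, h | h⟩
      · exact congrArg Prod.fst (huniq (e, true) he (by simpa [arcHead, h] using hv₀))
      · exact congrArg Prod.fst (huniq (e, false) he (by simpa [arcHead, h] using hv₀))
    · rintro e he rfl
      exact hv₀ he

open ArcBranching in
theorem exists_mem_of_reaches {P : LOG V E} {r : V} {A : Finset (E × Bool)}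
    (hinj : P.InjectiveLabels) (hr : ∀ e, P.label e ≠ r)
    (hA : ∀ v, Reaches P.arcTail P.arcHead A v r) (e : E) : ∃ b, (e, b) ∈ A := by
  rcases (hA (P.label e)).cases_head with h | ⟨_, ⟨⟨e', b⟩, ha, ht, -⟩, -⟩
  · exact (hr e h).elim
  · obtain rfl : e' = e := hinj ht
    exact ⟨b, ha⟩

end LOG

/-- **(Huck–Rosebrock).** Let `P` be a compressed injective labeled oriented tree that does
not contain a boundary reducible sub-LOT.  Then there is a reorientation `Q` of `P` such
that the positive graph `W⁺(Q)` and the negative graph `W⁻(Q)` are both trees. -/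
theorem exists_reorientation_Wpos_Wneg_tree {V E : Type} [Fintype V] [Fintype E]
    (P : LOG V E) (htree : P.IsTreeGraph) (hcomp : P.Compressed)
    (hinj : P.InjectiveLabels)
    (hnb : ∀ (VS : Set V) (ES : Set E), P.IsSubLOT VS ES → ¬ P.BoundaryReducibleSub VS ES) :
    ∃ Q : LOG V E, IsReorientation P Q ∧ Q.Wplus.IsTree ∧ Q.Wminus.IsTree := by
  classical
  obtain ⟨r, hr, hlabel⟩ := htree.exists_unique_not_label hinj
  obtain ⟨A, hA, hAc⟩ := ArcBranching.exists_disjoint_reaches (tail := P.arcTail)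
    (head := P.arcHead) (r := r) fun S hS hrS => htree.two_le_card_outArcs hinj hnb hS
      fun v hv => hlabel v fun h => hrS (h ▸ hv)
  have hmem : ∀ e, ∃ b, (e, b) ∈ A ∧ (e, !b) ∉ A := by
    intro e
    obtain ⟨b, hb⟩ := LOG.exists_mem_of_reaches hinj hr hA e
    obtain ⟨b', hb'⟩ := LOG.exists_mem_of_reaches hinj hr hAc e
    rw [Finset.mem_compl] at hb'
    refine ⟨b, hb, ?_⟩
    cases b <;> cases b' <;> simp_all
  choose σ hσ hσ' using hmem
  have hσA : ∀ e b, (e, b) ∈ A → b = σ e := fun e b hb => by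
    by_contra h
    exact hσ' e (Bool.eq_not.2 h ▸ hb)
  have hσAc : ∀ e b, (e, b) ∈ Aᶜ → b = !σ e := fun e b hb => by
    refine Bool.eq_not.2 fun h => ?_
    subst h
    exact Finset.mem_compl.1 hb (hσ e)
  refine ⟨⟨fun e => P.arcHead (e, σ e), P.label, fun e => P.arcHead (e, !σ e)⟩, ⟨rfl, fun e => ?_⟩,
    ?_, ?_⟩
  · cases h : σ e <;> simp [LOG.arcHead, h]
  · refine Multigraph.isTree_of_reaches _ P.label (fun e => P.arcHead (e, σ e)) hinj hr
      (fun e => .inr ⟨rfl, rfl⟩) fun v => Relation.ReflTransGen.mono ?_ _ _ (hA v)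
    rintro x y ⟨⟨e, b⟩, ha, hx, hy⟩
    exact ⟨e, hx, hσA e b ha ▸ hy⟩
  · refine Multigraph.isTree_of_reaches _ P.label (fun e => P.arcHead (e, !σ e)) hinj hr
      (fun e => .inl ⟨rfl, rfl⟩) fun v => Relation.ReflTransGen.mono ?_ _ _ (hAc v)
    rintro x y ⟨⟨e, b⟩, ha, hx, hy⟩
    exact ⟨e, hx, hσAc e b ha ▸ hy⟩
end
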